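/- arXiv:math/0109140 — 2 statements merged into one kernel-verified Lean document; each statement's English description precedes it below -/
import Mathlib

section
/- There is a bijection φ : V → W, where V is the set of all a-tuples of the form (i_1,…,i_k, n, n̄, j_1,…,j_{a−2−k}) with 0 ≤ k ≤ a−2, i_1 ≺ i_2 ≺ ⋯ ≺ i_k ⪯ n and n̄ ⪯ j_1 ≺ j_2 ≺ ⋯ ≺ j_{a−2−k} in J, and W is the set of all strictly increasing a-tuples (i_1 ≺ ⋯ ≺ i_a) in J for which the admissibility condition fails (i.e., there exist positions k < l and 1 ≤ c ≤ n with i_k = c, i_l = c̄ and n + k − l < c), such that φ preserves all weights: for every commutative ring K, every family of functions z_i : ℂ → K (i ∈ J) satisfying z_b(u)·z_{b̄}(u − n + b − 2) = z_{b−1}(u)·z_{\overline{b−1}}(u − n + b − 2) for all 2 ≤ b ≤ n and all u ∈ ℂ, and every v ∈ ℂ, one has ∏_{k=1}^{a} z_{(φ t)_k}(v + 1 − k) = ∏_{k=1}^{a} z_{t_k}(v + 1 − k) for every t ∈ V. -/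
noncomputable section

/-- membership in the set `V`: tableaux of the form
`(i_1 ≺ ⋯ ≺ i_k ⪯ n, n, n̄, n̄ ⪯ j_1 ≺ ⋯ ≺ j_{a-2-k})` with `0 ≤ k ≤ a-2`.
Letters of `J = {1 ≺ ⋯ ≺ n ≺ n̄ ≺ ⋯ ≺ 1̄}` are encoded as `Fin (2n)`: the letter
`c` is `c - 1`, the letter `c̄` is `2n - c`. -/
def isVtab (n a : ℕ) (t : Fin a → Fin (2 * n)) : Prop :=
  ∃ k : ℕ, k + 2 ≤ a ∧
    (∀ r : Fin a, (r : ℕ) < k → (t r : ℕ) + 1 ≤ n) ∧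
    (∀ r s : Fin a, (r : ℕ) < (s : ℕ) → (s : ℕ) < k → t r < t s) ∧
    (∀ r : Fin a, (r : ℕ) = k → (t r : ℕ) + 1 = n) ∧
    (∀ r : Fin a, (r : ℕ) = k + 1 → (t r : ℕ) + 1 = n + 1) ∧
    (∀ r : Fin a, k + 2 ≤ (r : ℕ) → n + 1 ≤ (t r : ℕ) + 1) ∧
    (∀ r s : Fin a, k + 2 ≤ (r : ℕ) → (r : ℕ) < (s : ℕ) → t r < t s)

/-- membership in the set `W`: strictly increasing tableaux for which the
admissibility condition fails, i.e. there are positions `k < l` and a letter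
`1 ≤ c ≤ n` with `i_k = c`, `i_l = c̄` and `n + k - l < c`. -/
def isWtab (n a : ℕ) (t : Fin a → Fin (2 * n)) : Prop :=
  StrictMono t ∧
    ∃ (k l : Fin a) (c : ℕ), k < l ∧ 1 ≤ c ∧ c ≤ n ∧
      (t k : ℕ) + 1 = c ∧ (t l : ℕ) + 1 = 2 * n + 1 - c ∧
      (n : ℤ) + ((k : ℕ) : ℤ) - ((l : ℕ) : ℤ) < (c : ℤ)

open Finset

theorem prod_lift {K : Type*} [CommMonoid K] (f g : ℕ → ℕ → K) (c R T h : ℕ)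
    (hfg : ∀ r s, r + s = c + 1 → f c r * g c s = f (c + 1) r * g (c + 1) s)
    (hs : R + T + h = c + 2) :
    (∏ i ∈ range h, f c (R + i)) * ∏ i ∈ range h, g c (T + i) =
      (∏ i ∈ range h, f (c + 1) (R + i)) * ∏ i ∈ range h, g (c + 1) (T + i) := by
  rw [← prod_range_reflect (fun i => g c (T + i)),
    ← prod_range_reflect (fun i => g (c + 1) (T + i)), ← prod_mul_distrib, ← prod_mul_distrib]
  refine prod_congr rfl fun i hi => hfg _ _ ?_
  have := mem_range.1 hi
  omega

/-- `(X', Y')` arises from `(X, Y)` by exchanging "both" and "neither" below level `m`. -/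
structure IsFlip (m : ℕ) (X Y X' Y' : ℕ → Prop) : Prop where
  left_lt : ∀ c < m, (X' c ↔ ¬ Y c)
  right_lt : ∀ c < m, (Y' c ↔ ¬ X c)
  left_ge : ∀ c, m ≤ c → (X' c ↔ X c)
  right_ge : ∀ c, m ≤ c → (Y' c ↔ Y c)

namespace IsFlip

variable {m : ℕ} {X Y X' Y' : ℕ → Prop}

theorem symm (H : IsFlip m X Y X' Y') : IsFlip m Y X Y' X' :=
  ⟨H.right_lt, H.left_lt, H.right_ge, H.left_ge⟩

theorem count_add_count [DecidablePred Y] [DecidablePred X']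
    (H : IsFlip m X Y X' Y') {c : ℕ} (hc : c ≤ m) :
    Nat.count X' c + Nat.count Y c = c := by
  induction c with
  | zero => simp
  | succ c ih =>
    have h1 := ih (by omega)
    have h2 := H.left_lt c hc
    rw [Nat.count_succ, Nat.count_succ]
    by_cases hY : Y c <;> simp [h2, hY] <;> omega

theorem count_left_ge [DecidablePred X] [DecidablePred X']
    (H : IsFlip m X Y X' Y') {c : ℕ} (hc : m ≤ c) :
    Nat.count X' c + Nat.count X m = Nat.count X c + Nat.count X' m := by
  induction c, hc using Nat.le_induction with
  | base => omega
  | succ c hc ih =>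
    rw [Nat.count_succ, Nat.count_succ]
    simp only [H.left_ge c hc]
    omega

variable [DecidablePred X] [DecidablePred Y] [DecidablePred X'] [DecidablePred Y']

theorem prod_eq_of_le {K : Type*} [CommRing K] (H : IsFlip m X Y X' Y') (f g : ℕ → ℕ → K)
    (hfg : ∀ c, c + 1 < m → ∀ r s, r + s = c + 1 →
      f c r * g c s = f (c + 1) r * g (c + 1) s)
    (hpos : ∀ c < m, c ≤ Nat.count X c + Nat.count Y c)
    (hend : Nat.count X m + Nat.count Y m + 1 = m) (c h : ℕ) (hc : c ≤ m)
    (hh : c + h = Nat.count X c + Nat.count Y c + 1) :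
    f 0 0 * g 0 0 * ((∏ i ∈ range c, if X i then f i (Nat.count X i + 1) else 1) *
        ∏ i ∈ range c, if Y i then g i (Nat.count Y i + 1) else 1) =
      ((∏ i ∈ range c, if X' i then f i (Nat.count X' i) else 1) *
        ∏ i ∈ range c, if Y' i then g i (Nat.count Y' i) else 1) *
      ((∏ i ∈ range h, f c (Nat.count X' c + i)) *
        ∏ i ∈ range h, g c (Nat.count Y' c + i)) := by
  induction c generalizing h with
  | zero =>
    obtain rfl : h = 1 := by simpa using hh
    simp
  | succ c ih =>
    obtain ⟨h₀, hh₀⟩ : ∃ h₀, c + h₀ = Nat.count X c + Nat.count Y c + 1 :=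
      ⟨_, Nat.add_sub_of_le ((hpos c hc).trans (Nat.le_succ _))⟩
    have IH := ih h₀ (by omega) hh₀
    have e1 := H.count_add_count (c := c) (by omega)
    have e2 := H.symm.count_add_count (c := c) (by omega)
    have e3 := H.count_add_count hc
    have e4 := H.symm.count_add_count hc
    have hlift : (∏ i ∈ range h, f c (Nat.count X' (c + 1) + i)) *
        ∏ i ∈ range h, g c (Nat.count Y' (c + 1) + i) =
        (∏ i ∈ range h, f (c + 1) (Nat.count X' (c + 1) + i)) *
        ∏ i ∈ range h, g (c + 1) (Nat.count Y' (c + 1) + i) := by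
      rcases Nat.eq_or_lt_of_le hc with hcm | hcm
      · obtain rfl : h = 0 := by subst hcm; omega
        simp
      · exact prod_lift f g c _ _ h (hfg c hcm) (by omega)
    rw [← hlift]
    simp only [prod_range_succ _ c]
    have hx := H.left_lt c hc
    have hy := H.right_lt c hc
    have hXr : Nat.count X c + 1 = Nat.count X' c + h₀ := by omega
    have hYr : Nat.count Y c + 1 = Nat.count Y' c + h₀ := by omega
    rw [hXr, hYr]
    rw [Nat.count_succ, Nat.count_succ] at hh ⊢
    generalize Nat.count X' c = R at *
    generalize Nat.count Y' c = T at *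
    generalize (∏ i ∈ range c, if X i then f i (Nat.count X i + 1) else 1) = PX at IH ⊢
    generalize (∏ i ∈ range c, if Y i then g i (Nat.count Y i + 1) else 1) = PY at IH ⊢
    generalize (∏ i ∈ range c, if X' i then f i (Nat.count X' i) else 1) = PX' at IH ⊢
    generalize (∏ i ∈ range c, if Y' i then g i (Nat.count Y' i) else 1) = PY' at IH ⊢
    have shift : ∀ (F : ℕ → ℕ → K) (R k : ℕ), F c R * ∏ i ∈ range k, F c (R + 1 + i) =
        ∏ i ∈ range (k + 1), F c (R + i) := fun F R k => by
      rw [prod_range_succ', mul_comm]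
      simp [add_assoc, add_comm 1]
    by_cases hX : X c <;> by_cases hY : Y c <;>
      simp only [hX, hY, hx, hy, not_true_eq_false, not_false_eq_true, if_true, if_false,
        mul_one, add_zero] at hh ⊢
    · obtain rfl : h = h₀ + 1 := by omega
      rw [prod_range_succ, prod_range_succ]
      linear_combination f c (R + h₀) * g c (T + h₀) * IH
    · obtain rfl : h = h₀ := by omega
      have := shift f R h
      rw [prod_range_succ] at this
      linear_combination f c (R + h) * IH - PX' * PY' * (∏ i ∈ range h, g c (T + i)) * this
    · obtain rfl : h = h₀ := by omega
      have := shift g T h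
      rw [prod_range_succ] at this
      linear_combination g c (T + h) * IH - PX' * PY' * (∏ i ∈ range h, f c (R + i)) * this
    · obtain rfl : h₀ = h + 1 := by omega
      rw [IH, ← shift f, ← shift g]
      ring

theorem prod_eq {K : Type*} [CommRing K] (H : IsFlip m X Y X' Y') (f g : ℕ → ℕ → K)
    (hfg : ∀ c, c + 1 < m → ∀ r s, r + s = c + 1 →
      f c r * g c s = f (c + 1) r * g (c + 1) s)
    (hpos : ∀ c < m, c ≤ Nat.count X c + Nat.count Y c)
    (hend : Nat.count X m + Nat.count Y m + 1 = m) {n : ℕ} (hn : m ≤ n) :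
    f 0 0 * g 0 0 * ((∏ i ∈ range n, if X i then f i (Nat.count X i + 1) else 1) *
        ∏ i ∈ range n, if Y i then g i (Nat.count Y i + 1) else 1) =
      (∏ i ∈ range n, if X' i then f i (Nat.count X' i) else 1) *
        ∏ i ∈ range n, if Y' i then g i (Nat.count Y' i) else 1 := by
  induction n, hn using Nat.le_induction with
  | base =>
    rw [H.prod_eq_of_le f g hfg hpos hend m 0 le_rfl (by omega)]
    simp
  | succ n hn ih =>
    have e1 := H.count_left_ge hn
    have e2 := H.symm.count_left_ge hn
    have e3 := H.count_add_count le_rfl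
    have e4 := H.symm.count_add_count le_rfl
    simp only [prod_range_succ _ n, H.left_ge n hn, H.right_ge n hn]
    rw [show Nat.count X n + 1 = Nat.count X' n by omega,
      show Nat.count Y n + 1 = Nat.count Y' n by omega, mul_mul_mul_comm (∏ i ∈ range n, _),
      ← mul_assoc, ih, mul_mul_mul_comm]

end IsFlip

/-- The unbarred letter of level `c` lies in `S`. -/
abbrev Lower (n : ℕ) (S : Finset ℕ) (c : ℕ) : Prop := c < n ∧ n - 1 - c ∈ S

/-- The barred letter of level `c` lies in `S`. -/
abbrev Upper (n : ℕ) (S : Finset ℕ) (c : ℕ) : Prop := n + c ∈ S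

/-- The number of letters of `S` of level below `c`, compared with `c`. -/
def height (n : ℕ) (S : Finset ℕ) (c : ℕ) : ℤ :=
  (Nat.count (Lower n S) c : ℤ) + Nat.count (Upper n S) c - c

/-- Reflected complement of `S` on the levels below `m`. -/
def flipSet (n m : ℕ) (S : Finset ℕ) : Finset ℕ :=
  {x ∈ range (2 * n) | if n ≤ x + m ∧ x < n + m then 2 * n - 1 - x ∉ S else x ∈ S}

theorem mem_flipSet {n m x : ℕ} {S : Finset ℕ} : x ∈ flipSet n m S ↔
    x < 2 * n ∧ if n ≤ x + m ∧ x < n + m then 2 * n - 1 - x ∉ S else x ∈ S := by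
  simp [flipSet]

theorem flipSet_subset (n m : ℕ) (S : Finset ℕ) : flipSet n m S ⊆ range (2 * n) :=
  filter_subset _ _

theorem flipSet_flipSet {n m : ℕ} {S : Finset ℕ} (hS : S ⊆ range (2 * n)) :
    flipSet n m (flipSet n m S) = S := by
  ext x
  have hx : x ∈ S → x < 2 * n := fun h => mem_range.1 (hS h)
  by_cases h2 : x < 2 * n
  · have e : 2 * n - 1 - (2 * n - 1 - x) = x := by omega
    have l : 2 * n - 1 - x < 2 * n := by omega
    by_cases hw : n ≤ x + m ∧ x < n + m
    · have hw' : n ≤ 2 * n - 1 - x + m ∧ 2 * n - 1 - x < n + m := by omega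
      rw [mem_flipSet, if_pos hw, mem_flipSet, if_pos hw', e]
      simp [h2, l]
    · rw [mem_flipSet, if_neg hw, mem_flipSet, if_neg hw]
      simp [h2]
  · rw [mem_flipSet]
    tauto

theorem isFlip_flipSet {n m : ℕ} {S : Finset ℕ} (hm : m ≤ n) (hS : S ⊆ range (2 * n)) :
    IsFlip m (Lower n S) (Upper n S) (Lower n (flipSet n m S)) (Upper n (flipSet n m S)) where
  left_lt c hc := by
    have h1 : n ≤ n - 1 - c + m ∧ n - 1 - c < n + m := by omega
    have h2 : 2 * n - 1 - (n - 1 - c) = n + c := by omega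
    rw [Lower, mem_flipSet, if_pos h1, h2]
    exact ⟨fun h => h.2.2, fun h => ⟨by omega, by omega, h⟩⟩
  right_lt c hc := by
    have h1 : n ≤ n + c + m ∧ n + c < n + m := by omega
    have h2 : 2 * n - 1 - (n + c) = n - 1 - c := by omega
    rw [Upper, mem_flipSet, if_pos h1, h2, Lower, not_and]
    exact ⟨fun h _ => h.2, fun h => ⟨by omega, h (by omega)⟩⟩
  left_ge c hc := by
    refine and_congr_right fun hcn => ?_
    have h1 : ¬ (n ≤ n - 1 - c + m ∧ n - 1 - c < n + m) := by omega
    rw [mem_flipSet, if_neg h1]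
    exact and_iff_right (by omega)
  right_ge c hc := by
    have h1 : ¬ (n ≤ n + c + m ∧ n + c < n + m) := by omega
    rw [Upper, mem_flipSet, if_neg h1]
    exact and_iff_right_of_imp fun h => mem_range.1 (hS h)

theorem height_zero (n : ℕ) (S : Finset ℕ) : height n S 0 = 0 := by simp [height]

theorem height_succ (n : ℕ) (S : Finset ℕ) (c : ℕ) : height n S (c + 1) =
    height n S c + (if Lower n S c then 1 else 0) + (if Upper n S c then 1 else 0) - 1 := by
  simp only [height, Nat.count_succ]
  push_cast
  ring

theorem height_flipSet_of_le {n m c : ℕ} {S : Finset ℕ} (hm : m ≤ n) (hS : S ⊆ range (2 * n))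
    (hc : c ≤ m) : height n (flipSet n m S) c = -height n S c := by
  have h1 := (isFlip_flipSet hm hS).count_add_count hc
  have h2 := (isFlip_flipSet hm hS).symm.count_add_count hc
  simp only [height]
  omega

theorem height_flipSet_of_ge {n m c : ℕ} {S : Finset ℕ} (hm : m ≤ n) (hS : S ⊆ range (2 * n))
    (hc : m ≤ c) : height n (flipSet n m S) c = height n S c - 2 * height n S m := by
  have h1 := (isFlip_flipSet hm hS).count_left_ge hc
  have h2 := (isFlip_flipSet hm hS).symm.count_left_ge hc
  have h3 := height_flipSet_of_le hm hS le_rfl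
  simp only [height] at h3 ⊢
  omega

theorem count_sub_add_count_lower {n c : ℕ} (S : Finset ℕ) (hc : c ≤ n) :
    Nat.count (· ∈ S) (n - c) + Nat.count (Lower n S) c = Nat.count (· ∈ S) n := by
  induction c with
  | zero => simp
  | succ c ih =>
    rw [← ih (by omega), show n - c = n - (c + 1) + 1 by omega, Nat.count_succ, Nat.count_succ]
    have : Lower n S c ↔ n - (c + 1) ∈ S := by
      rw [show n - (c + 1) = n - 1 - c by omega]
      exact and_iff_right hc
    simp only [this]
    omega

theorem count_lower_self (n : ℕ) (S : Finset ℕ) :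
    Nat.count (Lower n S) n = Nat.count (· ∈ S) n := by
  simpa using count_sub_add_count_lower S (le_refl n)

theorem count_add_eq (n c : ℕ) (S : Finset ℕ) :
    Nat.count (· ∈ S) (n + c) = Nat.count (· ∈ S) n + Nat.count (Upper n S) c :=
  Nat.count_add _ _ _

theorem count_eq_card {N : ℕ} {S : Finset ℕ} (hS : S ⊆ range N) :
    Nat.count (· ∈ S) N = #S := by
  rw [Nat.count_eq_card_filter_range, filter_mem_eq_inter, inter_eq_right.2 hS]

theorem height_self {n : ℕ} {S : Finset ℕ} (hS : S ⊆ range (2 * n)) :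
    height n S n = #S - n := by
  rw [height, count_lower_self, ← count_eq_card hS, two_mul, count_add_eq]
  push_cast
  ring

/-- `m` is the first level at which the height, multiplied by `σ = ±1`, reaches `1`. -/
structure IsFirstHit (n : ℕ) (S : Finset ℕ) (σ : ℤ) (m : ℕ) : Prop where
  le : m ≤ n
  hit : σ * height n S m = 1
  lt : ∀ c < m, σ * height n S c ≤ 0

namespace IsFirstHit

variable {n : ℕ} {S : Finset ℕ} {σ : ℤ} {m m' : ℕ}

theorem unique (h : IsFirstHit n S σ m) (h' : IsFirstHit n S σ m') : m = m' := by
  rcases lt_trichotomy m m' with hlt | heq | hlt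
  · have := h'.lt m hlt
    have := h.hit
    omega
  · exact heq
  · have := h.lt m' hlt
    have := h'.hit
    omega

theorem flipSet (h : IsFirstHit n S σ m) (hS : S ⊆ range (2 * n)) :
    IsFirstHit n (flipSet n m S) (-σ) m where
  le := h.le
  hit := by rw [height_flipSet_of_le h.le hS le_rfl, neg_mul_neg, h.hit]
  lt c hc := by
    rw [height_flipSet_of_le h.le hS hc.le, neg_mul_neg]
    exact h.lt c hc

theorem exists_of_pos (hσ : σ = 1 ∨ σ = -1) {c : ℕ} (hc : c ≤ n)
    (hpos : 0 < σ * height n S c) : ∃ m, IsFirstHit n S σ m := by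
  classical
  have hex : ∃ c, 0 < σ * height n S c := ⟨c, hpos⟩
  have hlt : ∀ c < Nat.find hex, σ * height n S c ≤ 0 := fun c hc =>
    not_lt.1 (Nat.find_min hex hc)
  refine ⟨Nat.find hex, (Nat.find_min' hex hpos).trans hc, ?_, hlt⟩
  have hspec := Nat.find_spec hex
  rcases hm : Nat.find hex with _ | k
  · rw [hm, height_zero] at hspec
    simp at hspec
  · have hk := hlt k (by omega)
    rw [hm, height_succ] at hspec
    rw [height_succ]
    rcases hσ with rfl | rfl <;> split_ifs at hspec ⊢ <;> omega

end IsFirstHit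

/-- The letter sets of the strictly increasing tableaux of height `a`. -/
abbrev LetterSet (n a : ℕ) : Type := {S : Finset ℕ // S ⊆ range (2 * n) ∧ #S = a}

theorem exists_isFirstHit_neg {n a : ℕ} (ha : a + 1 ≤ n) (S : LetterSet n a) :
    ∃ m, IsFirstHit n S.1 (-1) m := by
  refine IsFirstHit.exists_of_pos (.inr rfl) le_rfl ?_
  rw [height_self S.2.1, S.2.2]
  omega

/-- The reflection principle for the height path. -/
def reflectEquiv (n a : ℕ) (ha : a + 1 ≤ n) :
    LetterSet n a ≃ {S : LetterSet n (a + 2) // ∃ m, IsFirstHit n S.1 1 m} where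
  toFun S := by
    refine ⟨⟨flipSet n (exists_isFirstHit_neg ha S).choose S.1, flipSet_subset _ _ _, ?_⟩,
      (exists_isFirstHit_neg ha S).choose,
      by simpa using (exists_isFirstHit_neg ha S).choose_spec.flipSet S.2.1⟩
    have h := (exists_isFirstHit_neg ha S).choose_spec
    have h1 := height_flipSet_of_ge h.le S.2.1 h.le
    have h2 := h.hit
    rw [height_self (flipSet_subset _ _ _), height_self S.2.1, S.2.2] at h1
    omega
  invFun S := by
    refine ⟨flipSet n S.2.choose S.1.1, flipSet_subset _ _ _, ?_⟩
    have h := S.2.choose_spec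
    have h1 := height_flipSet_of_ge h.le S.1.2.1 h.le
    have h2 := h.hit
    rw [height_self (flipSet_subset _ _ _), height_self S.1.2.1, S.1.2.2] at h1
    omega
  left_inv S := by
    apply Subtype.ext
    have h := (exists_isFirstHit_neg ha S).choose_spec
    have h' : ∃ m, IsFirstHit n (flipSet n (exists_isFirstHit_neg ha S).choose S.1) 1 m :=
      ⟨_, by simpa using h.flipSet S.2.1⟩
    have e : h'.choose = (exists_isFirstHit_neg ha S).choose :=
      h'.choose_spec.unique (by simpa using h.flipSet S.2.1)
    change flipSet n h'.choose _ = _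
    rw [e, flipSet_flipSet S.2.1]
  right_inv S := by
    apply Subtype.ext
    apply Subtype.ext
    have h := S.2.choose_spec
    have h' : ∃ m, IsFirstHit n (flipSet n S.2.choose S.1.1) (-1) m := ⟨_, h.flipSet S.1.2.1⟩
    have e : h'.choose = S.2.choose := h'.choose_spec.unique (h.flipSet S.1.2.1)
    change flipSet n h'.choose _ = _
    rw [e, flipSet_flipSet S.1.2.1]

theorem reflectEquiv_apply (n a : ℕ) (ha : a + 1 ≤ n) (S : LetterSet n a) :
    ∃ m, IsFirstHit n S.1 (-1) m ∧ ((reflectEquiv n a ha S).1 : Finset ℕ) = flipSet n m S.1 :=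
  ⟨_, (exists_isFirstHit_neg ha S).choose_spec, rfl⟩

/-- The set of letters of a tableau. -/
def letters {n a : ℕ} (t : Fin a → Fin (2 * n)) : Finset ℕ :=
  univ.image fun r => (t r : ℕ)

theorem mem_letters {n a x : ℕ} {t : Fin a → Fin (2 * n)} :
    x ∈ letters t ↔ ∃ r, (t r : ℕ) = x := by
  simp [letters]

theorem letters_subset {n a : ℕ} (t : Fin a → Fin (2 * n)) : letters t ⊆ range (2 * n) := by
  intro x hx
  obtain ⟨r, rfl⟩ := mem_letters.1 hx
  exact mem_range.2 (t r).2

theorem strictMono_val {n a : ℕ} {t : Fin a → Fin (2 * n)} (ht : StrictMono t) :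
    StrictMono fun r => (t r : ℕ) := fun _ _ h => ht h

theorem card_letters {n a : ℕ} {t : Fin a → Fin (2 * n)} (ht : StrictMono t) :
    #(letters t) = a := by
  rw [letters, card_image_of_injective _ (strictMono_val ht).injective, card_fin]

theorem count_letters {n a : ℕ} {t : Fin a → Fin (2 * n)} (ht : StrictMono t) (r : Fin a) :
    Nat.count (· ∈ letters t) (t r) = r := by
  rw [Nat.count_eq_card_filter_range]
  have : {x ∈ range (t r : ℕ) | x ∈ letters t} = (Iio r).image fun s => (t s : ℕ) := by
    ext x
    simp only [mem_filter, mem_range, mem_letters, mem_image, mem_Iio]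
    constructor
    · rintro ⟨hx, s, rfl⟩
      exact ⟨s, ht.lt_iff_lt.1 hx, rfl⟩
    · rintro ⟨s, hs, rfl⟩
      exact ⟨ht hs, s, rfl⟩
  rw [this, card_image_of_injective _ (strictMono_val ht).injective, Fin.card_Iio]

/-- Strictly increasing tableaux are determined by their sets of letters. -/
def lettersEquiv (n a : ℕ) :
    {t : Fin a → Fin (2 * n) // StrictMono t} ≃ LetterSet n a where
  toFun t := ⟨letters t.1, letters_subset t.1, card_letters t.2⟩
  invFun S := ⟨fun r => ⟨S.1.orderEmbOfFin S.2.2 r,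
    mem_range.1 (S.2.1 (orderEmbOfFin_mem _ _ _))⟩,
    fun _ _ h => (S.1.orderEmbOfFin S.2.2).strictMono h⟩
  left_inv t := by
    apply Subtype.ext
    funext r
    apply Fin.ext
    exact (congrFun (orderEmbOfFin_unique (card_letters t.2)
      (fun r => mem_letters.2 ⟨r, rfl⟩) (strictMono_val t.2)) r).symm
  right_inv S := by
    apply Subtype.ext
    exact image_orderEmbOfFin_univ S.1 S.2.2

theorem isWtab_iff {n a : ℕ} {t : Fin a → Fin (2 * n)} (ht : StrictMono t) :
    isWtab n a t ↔ ∃ m, IsFirstHit n (letters t) 1 m := by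
  constructor
  · rintro ⟨-, k, l, c, -, h1, hcn, hk, hl, hlt⟩
    obtain ⟨d, rfl⟩ : ∃ d, n = c + d := ⟨n - c, by omega⟩
    have hk' : (t k : ℕ) = c + d - (d + 1) := by omega
    have hl' : (t l : ℕ) = c + d + d := by omega
    have e1 := count_sub_add_count_lower (n := c + d) (c := d + 1) (letters t) (by omega)
    have e2 := count_add_eq (c + d) d (letters t)
    rw [← hk', count_letters ht] at e1
    rw [← hl', count_letters ht] at e2
    have hL : Lower (c + d) (letters t) d := ⟨by omega, mem_letters.2 ⟨k, by omega⟩⟩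
    have hU : Upper (c + d) (letters t) d := mem_letters.2 ⟨l, hl'⟩
    refine IsFirstHit.exists_of_pos (c := d + 1) (.inl rfl) (by omega) ?_
    simp only [height, Nat.count_succ, if_pos hL, if_pos hU] at e1 ⊢
    push_cast at *
    omega
  · rintro ⟨m, hm, hit, hlt⟩
    refine ⟨ht, ?_⟩
    rcases m with _ | d
    · rw [height_zero] at hit
      omega
    have h0 := hlt d (by omega)
    rw [height_succ] at hit
    have hL : Lower n (letters t) d := by
      by_contra h
      rw [if_neg h] at hit
      split_ifs at hit <;> omega
    have hU : Upper n (letters t) d := by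
      by_contra h
      rw [if_pos hL, if_neg h] at hit
      omega
    obtain ⟨k, hk⟩ := mem_letters.1 hL.2
    obtain ⟨l, hl⟩ := mem_letters.1 hU
    have e1 := count_sub_add_count_lower (n := n) (c := d + 1) (letters t) (by omega)
    have e2 := count_add_eq n d (letters t)
    rw [show n - (d + 1) = t k by omega, count_letters ht, Nat.count_succ, if_pos hL] at e1
    rw [← hl, count_letters ht] at e2
    rw [if_pos hL, if_pos hU, height] at hit
    refine ⟨k, l, n - d, ?_, by omega, by omega, by omega, by omega, by omega⟩
    rw [← ht.lt_iff_lt, Fin.lt_def]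
    omega

/-- Letter sets of the tableaux violating the admissibility condition. -/
def wtabEquiv (n a : ℕ) : {t : Fin a → Fin (2 * n) // isWtab n a t} ≃
    {S : LetterSet n a // ∃ m, IsFirstHit n S.1 1 m} :=
  (Equiv.subtypeSubtypeEquivSubtype fun h => h.1).symm.trans
    ((lettersEquiv n a).subtypeEquiv fun t => isWtab_iff t.2)

theorem prod_letters {K : Type*} [CommMonoid K] {n a : ℕ} {t : Fin a → Fin (2 * n)}
    (ht : StrictMono t) (F : ℕ → ℕ → K) :
    ∏ r : Fin a, F (t r) r =
      (∏ c ∈ range n, if Lower n (letters t) c then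
        F (n - 1 - c) (Nat.count (· ∈ letters t) n - 1 - Nat.count (Lower n (letters t)) c)
        else 1) *
      ∏ c ∈ range n, if Upper n (letters t) c then
        F (n + c) (Nat.count (· ∈ letters t) n + Nat.count (Upper n (letters t)) c) else 1 := by
  have h1 : ∏ r : Fin a, F (t r) r =
      ∏ x ∈ letters t, F x (Nat.count (· ∈ letters t) x) := by
    conv_rhs => rw [letters, prod_image fun _ _ _ _ h => (strictMono_val ht).injective h]
    exact prod_congr rfl fun r _ => by rw [← letters, count_letters ht]
  rw [h1, ← inter_eq_right.2 (letters_subset t), ← prod_ite_mem,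
    inter_eq_right.2 (letters_subset t), two_mul, prod_range_add, ← prod_range_reflect]
  congr 1
  · refine prod_congr rfl fun c hc => ?_
    have hc' := mem_range.1 hc
    by_cases h : n - 1 - c ∈ letters t
    · have e := count_sub_add_count_lower (n := n) (c := c + 1) (letters t) hc'
      rw [Nat.count_succ, if_pos ⟨hc', h⟩, show n - (c + 1) = n - 1 - c by omega] at e
      rw [if_pos h, if_pos ⟨hc', h⟩]
      congr 1
      omega
    · rw [if_neg h, if_neg fun h' => h h'.2]
  · refine prod_congr rfl fun c _ => ?_
    rw [count_add_eq]

theorem lt_count_letters_iff {n a : ℕ} {t : Fin a → Fin (2 * n)} (ht : StrictMono t) (N : ℕ)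
    (r : Fin a) : (r : ℕ) < Nat.count (· ∈ letters t) N ↔ (t r : ℕ) < N := by
  rw [← count_letters ht r]
  constructor
  · intro h
    by_contra! hN
    exact h.not_ge (Nat.count_monotone _ hN)
  · exact fun h => Nat.count_strict_mono (mem_letters.2 ⟨r, rfl⟩) h

theorem count_letters_le {n a : ℕ} {t : Fin a → Fin (2 * n)} (ht : StrictMono t) :
    Nat.count (· ∈ letters t) n ≤ a := by
  calc _ ≤ Nat.count (· ∈ letters t) (2 * n) := Nat.count_monotone _ (by omega)
    _ = a := by rw [count_eq_card (letters_subset t), card_letters ht]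

/-- Insertion of the letters `n`, `n̄` at the positions `k`, `k + 1`. -/
def insertPair {n a : ℕ} (hn : 0 < n) (k : ℕ) (hk : k ≤ a) (e : Fin a → Fin (2 * n))
    (r : Fin (a + 2)) : Fin (2 * n) :=
  if h₁ : (r : ℕ) < k then e ⟨r, by omega⟩
  else if h₂ : (r : ℕ) = k then ⟨n - 1, by omega⟩
  else if h₃ : (r : ℕ) = k + 1 then ⟨n, by omega⟩
  else e ⟨r - 2, by omega⟩

/-- The embedding of positions skipping `k` and `k + 1`. -/
def skipPair {a : ℕ} (k : ℕ) (i : Fin a) : Fin (a + 2) :=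
  ⟨if (i : ℕ) < k then i else i + 2, by split_ifs <;> omega⟩

theorem insertPair_skipPair {n a : ℕ} (hn : 0 < n) (k : ℕ) (hk : k ≤ a)
    (e : Fin a → Fin (2 * n)) (i : Fin a) : insertPair hn k hk e (skipPair k i) = e i := by
  by_cases h : (i : ℕ) < k
  · simp [insertPair, skipPair, h]
  · have h1 : ¬ (i : ℕ) + 2 < k := by omega
    have h2 : ¬ (i : ℕ) + 2 = k := by omega
    have h3 : ¬ (i : ℕ) + 1 = k := by omega
    simp [insertPair, skipPair, h, h1, h2, h3]

theorem prod_insertPair {K : Type*} [CommMonoid K] {n a : ℕ} (hn : 0 < n) (k : ℕ) (hk : k ≤ a)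
    (e : Fin a → Fin (2 * n)) (F : ℕ → ℕ → K) :
    ∏ r : Fin (a + 2), F (insertPair hn k hk e r) r =
      F (n - 1) k * F n (k + 1) * ∏ i : Fin a, F (e i) (if (i : ℕ) < k then i else i + 2) := by
  rw [Fin.prod_univ_succAbove _ ⟨k, by omega⟩, Fin.prod_univ_succAbove _ ⟨k, by omega⟩,
    ← mul_assoc]
  congr 1
  · simp [insertPair, Fin.succAbove]
  · refine prod_congr rfl fun i _ => ?_
    have : (⟨k, by omega⟩ : Fin (a + 2)).succAbove ((⟨k, by omega⟩ : Fin (a + 1)).succAbove i) =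
        skipPair k i := by
      ext
      simp only [Fin.succAbove, skipPair, Fin.lt_def]
      split_ifs <;> simp_all <;> omega
    rw [this, insertPair_skipPair]
    rfl

theorem isVtab_insertPair {n a k : ℕ} (hn : 0 < n) (hk : k ≤ a) {e : Fin a → Fin (2 * n)}
    (he : StrictMono e) (hlow : ∀ i : Fin a, (i : ℕ) < k ↔ (e i : ℕ) < n) :
    isVtab n (a + 2) (insertPair hn k hk e) := by
  have hlt : ∀ (r : Fin (a + 2)) (h : (r : ℕ) < k),
      insertPair hn k hk e r = e ⟨r, by omega⟩ := fun r h => by simp [insertPair, h]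
  have hge : ∀ (r : Fin (a + 2)) (h : k + 2 ≤ (r : ℕ)),
      insertPair hn k hk e r = e ⟨r - 2, by omega⟩ := fun r h => by
    rw [insertPair, dif_neg (by omega), dif_neg (by omega), dif_neg (by omega)]
  refine ⟨k, by omega, fun r hr => ?_, fun r s hrs hs => ?_, fun r hr => ?_, fun r hr => ?_,
    fun r hr => ?_, fun r s hr hrs => ?_⟩
  · rw [hlt r hr]
    exact (hlow _).1 hr
  · rw [hlt r (by omega), hlt s hs]
    exact he hrs
  · rw [insertPair, dif_neg (by omega), dif_pos hr, Nat.sub_add_cancel hn]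
  · rw [insertPair, dif_neg (by omega), dif_neg (by omega), dif_pos hr]
  · rw [hge r hr]
    have := mt (hlow ⟨r - 2, by omega⟩).2 (by simp; omega)
    omega
  · rw [hge r hr, hge s (by omega)]
    exact he (Fin.mk_lt_mk.2 (by omega))

theorem insertPair_pos_le {n a k k' : ℕ} (hn : 0 < n) (hk : k ≤ a) (hk' : k' ≤ a)
    {e e' : Fin a → Fin (2 * n)} (he' : ∀ i : Fin a, (i : ℕ) < k' → (e' i : ℕ) < n)
    (h : insertPair hn k hk e = insertPair hn k' hk' e') : k' ≤ k := by
  by_contra! hlt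
  have h1 := congrArg Fin.val (congrFun h ⟨k + 1, by omega⟩)
  by_cases h2 : k + 1 < k'
  · have := he' ⟨k + 1, by omega⟩ h2
    simp [insertPair, h2] at h1
    omega
  · obtain rfl : k' = k + 1 := by omega
    simp [insertPair] at h1
    omega

/-- Removing the distinguished pair `n`, `n̄` from a tableau in `V`. -/
def vtabEquiv (n a : ℕ) (hn : 0 < n) : {e : Fin a → Fin (2 * n) // StrictMono e} ≃
    {t : Fin (a + 2) → Fin (2 * n) // isVtab n (a + 2) t} :=
  Equiv.ofBijective (fun e => ⟨insertPair hn _ (count_letters_le e.2) e.1,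
    isVtab_insertPair hn _ e.2 (lt_count_letters_iff e.2 n)⟩) <| by
    constructor
    · rintro ⟨e, he⟩ ⟨e', he'⟩ h
      have h' := congrArg Subtype.val h
      simp only at h'
      have hk := le_antisymm
        (insertPair_pos_le hn _ _ (fun i => (lt_count_letters_iff he n i).1) h'.symm)
        (insertPair_pos_le hn _ _ (fun i => (lt_count_letters_iff he' n i).1) h')
      apply Subtype.ext
      funext i
      change e i = e' i
      rw [← insertPair_skipPair hn _ (count_letters_le he) e i, h']
      simp only [hk]
      exact insertPair_skipPair hn _ _ _ _
    · rintro ⟨t, k, hka, hlow, hlowMono, hk, hk1, hup, hupMono⟩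
      have hsk : ∀ i : Fin a, (t (skipPair k i) : ℕ) < n ↔ (i : ℕ) < k := fun i => by
        by_cases h : (i : ℕ) < k
        · have := hlow (skipPair k i) (by simp [skipPair, h])
          omega
        · have := hup (skipPair k i) (by simp [skipPair, h]; omega)
          omega
      have he : StrictMono fun i : Fin a => t (skipPair k i) := by
        intro i j hij
        have hij' : (i : ℕ) < j := hij
        by_cases hi : (i : ℕ) < k
        · by_cases hj : (j : ℕ) < k
          · exact hlowMono _ _ (by simp [skipPair, hi, hj, hij']) (by simp [skipPair, hj])
          · have h1 := (hsk i).2 hi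
            have h2 := mt (hsk j).1 hj
            exact Fin.lt_def.2 (h1.trans_le (not_lt.1 h2))
        · have hj : ¬ (j : ℕ) < k := by omega
          exact hupMono _ _ (by simp [skipPair, hi]; omega) (by simp [skipPair, hi, hj, hij'])
      have hcount : Nat.count (· ∈ letters fun i : Fin a => t (skipPair k i)) n = k := by
        have h1 := count_letters_le he
        have h2 := fun i => (lt_count_letters_iff he n i).trans (hsk i)
        generalize Nat.count (· ∈ letters fun i : Fin a => t (skipPair k i)) n = q at h1 h2 ⊢
        rcases lt_trichotomy q k with h | h | h
        · have := (h2 ⟨q, by omega⟩).2 h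
          simp at this
        · exact h
        · have := (h2 ⟨k, by omega⟩).1 h
          simp at this
      refine ⟨⟨_, he⟩, Subtype.ext (funext fun r => ?_)⟩
      simp only [hcount]
      rw [insertPair]
      split_ifs with h1 h2 h3
      · simp [skipPair, h1]
      · have := hk r h2
        exact Fin.ext (by simp; omega)
      · have := hk1 r h3
        exact Fin.ext (by simp; omega)
      · have h4 : ¬ (r : ℕ) - 2 < k := by omega
        congr 1
        ext
        simp [skipPair, h4]
        omega

theorem vtabEquiv_apply (n a : ℕ) (hn : 0 < n) (e : {e : Fin a → Fin (2 * n) // StrictMono e}) :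
    (vtabEquiv n a hn e).1 = insertPair hn _ (count_letters_le e.2) e.1 := rfl

theorem prod_vtabEquiv {K : Type*} [CommMonoid K] {n a : ℕ} (hn : 0 < n)
    (e : {e : Fin a → Fin (2 * n) // StrictMono e}) (F : ℕ → ℕ → K) :
    ∏ r : Fin (a + 2), F ((vtabEquiv n a hn e).1 r) r =
      F (n - 1) (Nat.count (· ∈ letters e.1) n) * F n (Nat.count (· ∈ letters e.1) n + 1) *
      ((∏ c ∈ range n, if Lower n (letters e.1) c then
        F (n - 1 - c) (Nat.count (· ∈ letters e.1) n - 1 - Nat.count (Lower n (letters e.1)) c)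
        else 1) *
      ∏ c ∈ range n, if Upper n (letters e.1) c then
        F (n + c) (Nat.count (· ∈ letters e.1) n + Nat.count (Upper n (letters e.1)) c + 2)
        else 1) := by
  have h := prod_letters e.2 fun x r => F x (if x < n then r else r + 2)
  rw [vtabEquiv_apply, prod_insertPair]
  simp only [lt_count_letters_iff e.2 n]
  rw [h]
  congr 2
  · refine prod_congr rfl fun c _ => ?_
    rw [if_pos (show n - 1 - c < n by omega)]
  · refine prod_congr rfl fun c _ => ?_
    rw [if_neg (show ¬ n + c < n by omega)]

/-- The weight-preserving bijection obtained from the reflection principle. -/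
def tableauEquiv (n a : ℕ) (ha : a + 2 ≤ n) :
    {t : Fin (a + 2) → Fin (2 * n) // isVtab n (a + 2) t} ≃
      {t : Fin (a + 2) → Fin (2 * n) // isWtab n (a + 2) t} :=
  (vtabEquiv n a (by omega)).symm.trans <| (lettersEquiv n a).trans <|
    (reflectEquiv n a (by omega)).trans (wtabEquiv n (a + 2)).symm

theorem letters_tableauEquiv (n a : ℕ) (ha : a + 2 ≤ n)
    (e : {e : Fin a → Fin (2 * n) // StrictMono e}) :
    ∃ m, IsFirstHit n (letters e.1) (-1) m ∧
      letters (tableauEquiv n a ha (vtabEquiv n a (by omega) e)).1 =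
        flipSet n m (letters e.1) := by
  obtain ⟨m, hm, h⟩ := reflectEquiv_apply n a (by omega) (lettersEquiv n a e)
  refine ⟨m, hm, ?_⟩
  have h1 : wtabEquiv n (a + 2) (tableauEquiv n a ha (vtabEquiv n a (by omega) e)) =
      reflectEquiv n a (by omega) (lettersEquiv n a e) := by
    simp [tableauEquiv]
  exact (congrArg (fun S => S.1.1) h1).trans h

theorem prod_tableauEquiv {K : Type*} [CommRing K] {n a : ℕ} (ha : a + 2 ≤ n) (z : ℕ → ℂ → K)
    (hz : ∀ b : ℕ, 2 ≤ b → b ≤ n → ∀ u : ℂ,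
      z b u * z (2 * n + 1 - b) (u - (n : ℂ) + (b : ℂ) - 2) =
        z (b - 1) u * z (2 * n + 2 - b) (u - (n : ℂ) + (b : ℂ) - 2)) (v : ℂ)
    (e : {e : Fin a → Fin (2 * n) // StrictMono e}) :
    (∏ k : Fin (a + 2), z ((tableauEquiv n a ha (vtabEquiv n a (by omega) e)).1 k + 1)
      (v - ((k : ℕ) : ℂ))) =
      ∏ k : Fin (a + 2), z ((vtabEquiv n a (by omega) e).1 k + 1) (v - ((k : ℕ) : ℂ)) := by
  obtain ⟨m, hm, hl⟩ := letters_tableauEquiv n a ha e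
  have hflip := isFlip_flipSet hm.le (letters_subset e.1)
  have hlast := hm.hit
  rw [prod_letters (tableauEquiv n a ha _).2.1 fun x r => z (x + 1) (v - (r : ℂ)),
    prod_vtabEquiv (by omega) e fun x r => z (x + 1) (v - (r : ℂ)), hl]
  have hp : Nat.count (· ∈ flipSet n m (letters e.1)) n =
      Nat.count (· ∈ letters e.1) n + 1 := by
    have h1 := hflip.count_left_ge hm.le
    have h2 := hflip.count_add_count le_rfl
    rw [count_lower_self, count_lower_self] at h1
    rw [height] at hlast
    omega
  have key := hflip.prod_eq
    (fun c r => z (n - c) (v - Nat.count (· ∈ letters e.1) n + r))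
    (fun c s => z (n + c + 1) (v - Nat.count (· ∈ letters e.1) n - 1 - s)) ?_ ?_ ?_ hm.le
  · rw [hp]
    refine Eq.trans ?_ (key.symm.trans ?_)
    · congr 1
      · refine prod_congr rfl fun c hc => ?_
        split_ifs with h
        · have hc' := mem_range.1 hc
          have hle := Nat.count_strict_mono h hc'
          rw [count_lower_self, hp] at hle
          rw [show n - 1 - c + 1 = n - c by omega, Nat.add_sub_cancel, Nat.cast_sub (by omega)]
          congr 1
          ring
        · rfl
      · refine prod_congr rfl fun c _ => ?_
        split_ifs
        · congr 1
          push_cast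
          ring
        · rfl
    · congr 1
      · rw [show n - 1 + 1 = n by omega]
        congr 2
        · simp
        · push_cast
          ring
      congr 1
      · refine prod_congr rfl fun c hc => ?_
        split_ifs with h
        · have hc' := mem_range.1 hc
          have hle := Nat.count_strict_mono h hc'
          rw [count_lower_self] at hle
          rw [show n - 1 - c + 1 = n - c by omega, Nat.sub_sub, Nat.cast_sub (by omega)]
          congr 1
          push_cast
          ring
        · rfl
      · refine prod_congr rfl fun c _ => ?_
        split_ifs
        · congr 1
          push_cast
          ring
        · rfl
  · intro c hc r s hrs
    have hmn := hm.le
    have h := hz (n - c) (by omega) (by omega) (v - Nat.count (· ∈ letters e.1) n + r)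
    have hrs' : (r : ℂ) + s = c + 1 := by exact_mod_cast hrs
    have hs : v - (Nat.count (· ∈ letters e.1) n : ℂ) + r - n + ((n - c : ℕ) : ℂ) - 2 =
        v - Nat.count (· ∈ letters e.1) n - 1 - s := by
      rw [Nat.cast_sub (by omega)]
      linear_combination hrs'
    rw [hs, show 2 * n + 1 - (n - c) = n + c + 1 by omega,
      show 2 * n + 2 - (n - c) = n + (c + 1) + 1 by omega,
      show n - c - 1 = n - (c + 1) by omega] at h
    exact h
  · intro c hc
    have := hm.lt c hc
    rw [height] at this
    omega
  · rw [height] at hlast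
    omega

/-- Proposition A.8: there is a weight-preserving bijection `φ : V → W`; it
preserves the weight `Z_v(t) = ∏_{k=1}^a z_{t_k}(v + 1 - k)` for every family of
functions `z` with values in a commutative ring satisfying
`z_b(u) z_{b̄}(u-n+b-2) = z_{b-1}(u) z_{\overline{b-1}}(u-n+b-2)` for `2 ≤ b ≤ n`. -/
theorem statement18 (n a : ℕ) (hn : 3 ≤ n) (ha1 : 3 ≤ a) (ha2 : a ≤ n) :
    ∃ φ : {t : Fin a → Fin (2 * n) // isVtab n a t} ≃
        {t : Fin a → Fin (2 * n) // isWtab n a t},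
      ∀ (K : Type*) [CommRing K] (z : ℕ → ℂ → K),
        (∀ b : ℕ, 2 ≤ b → b ≤ n → ∀ u : ℂ,
          z b u * z (2 * n + 1 - b) (u - (n : ℂ) + (b : ℂ) - 2) =
            z (b - 1) u * z (2 * n + 2 - b) (u - (n : ℂ) + (b : ℂ) - 2)) →
        ∀ (v : ℂ) (t : {t : Fin a → Fin (2 * n) // isVtab n a t}),
          (∏ k : Fin a, z (((φ t : {t : Fin a → Fin (2 * n) // isWtab n a t}).1 k : ℕ) + 1)
              (v - ((k : ℕ) : ℂ))) =
            ∏ k : Fin a, z ((t.1 k : ℕ) + 1) (v - ((k : ℕ) : ℂ)) := by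
  obtain ⟨a, rfl⟩ : ∃ a', a = a' + 2 := ⟨a - 2, by omega⟩
  refine ⟨tableauEquiv n a ha2, fun K _ z hz v t => ?_⟩
  obtain ⟨e, rfl⟩ := (vtabEquiv n a (by omega)).surjective t
  exact prod_tableauEquiv ha2 z hz v e
end
end

section
/- Weyl type and Jacobi-Trudi formulas for Casorati determinant ratios: let 0 = i_0 < i_1 < ⋯ < i_{N−1} be integers, let μ be the Young diagram (with fewer than N rows) given by μ_j = i_{N−j} + j − N for 1 ≤ j ≤ N−1, and let μ' be its transpose. Then for every u ∈ ℂ: [0, i_1, i_2, …, i_{N−1}](u) = (−1)^{μ_1}·( Σ_t ∏_{(α,β) ∈ (μ_1^N)/μ} x_{t(α,β)}(u + α + β − 2) )·[0,1,…,N−1](u) = det_{1 ≤ j,l ≤ μ_1}( T^{(μ'_j − j + l)}_1(u + (N − 2 + j + l − μ'_j)/2) )·[0,1,…,N−1](u), where [c_1,…,c_N](u) = det(w_j(u+c_r))_{1≤j,r≤N}, the sum Σ_t runs over all semistandard tableaux t of the skew Young diagram (μ_1^N)/μ with entries in {1,…,N} (entries weakly increasing along rows and strictly increasing along columns), and t(α,β)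 denotes the entry of t in the α-th row and β-th column counted from the bottom-left corner of the rectangle (μ_1^N). -/
attribute [local instance 10] Classical.propDecidable

noncomputable section

open Finset

variable {K : Type*} [CommRing K]

/-- `Y_a(u)` as a unit of `K`, with `Y_0(u) = 1`, where
`Y_a(u) = Q_a(u - d_a) Q_a(u + d_a)⁻¹`, `d_a = 1/2` for `a < n` and `d_n = 1`. -/
def Yq (n : ℕ) (Q : ℕ → ℂ → Kˣ) (a : ℕ) (u : ℂ) : Kˣ :=
  if a = 0 then 1
  else Q a (u - (if a = n then 1 else 2⁻¹)) * (Q a (u + (if a = n then 1 else 2⁻¹)))⁻¹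

/-- `z_i(u)` for `i = 1,…,2n`, where `i ≤ n` encodes the letter `i` of the alphabet
`J = {1 ≺ ⋯ ≺ n ≺ n̄ ≺ ⋯ ≺ 1̄}`, and `i > n` encodes the letter `\overline{2n+1-i}`. -/
def zq (n : ℕ) (Q : ℕ → ℂ → Kˣ) (i : ℕ) (u : ℂ) : Kˣ :=
  if i ≤ n then
    Yq n Q i (u + (i : ℂ) / 2) * (Yq n Q (i - 1) (u + ((i : ℂ) + 1) / 2))⁻¹
  else
    Yq n Q (2 * n - i) (u + ((i : ℂ) + 2) / 2) *
      (Yq n Q (2 * n + 1 - i) (u + ((i : ℂ) + 3) / 2))⁻¹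

/-- the common value `x_{n+1}(u) = -x_{n+2}(u)
  = Q_n(u+n/2) Q_n(u+(n+4)/2) Q_n(u+(n+2)/2)⁻²`. -/
def xqmid (n : ℕ) (Q : ℕ → ℂ → Kˣ) (u : ℂ) : K :=
  (Q n (u + (n : ℂ) / 2) : K) * (Q n (u + ((n : ℂ) + 4) / 2) : K) *
    (((Q n (u + ((n : ℂ) + 2) / 2))⁻¹ : Kˣ) : K) ^ 2

/-- `x_i(u)` for `i = 1,…,N = 2n+2`. -/
def xq (n : ℕ) (Q : ℕ → ℂ → Kˣ) (i : ℕ) (u : ℂ) : K :=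
  if i ≤ n then zq n Q i u
  else if i = n + 1 then xqmid n Q u
  else if i = n + 2 then -xqmid n Q u
  else zq n Q (i - 2) u

/-- admissibility of a column tableau: whenever `i_k = c` and `i_l = \bar c`
for some `1 ≤ c ≤ n`, one has `n + k - l ≥ c` (letters encoded as in `zq`,
positions `0`-based, which does not change the difference `k - l`). -/
def AdmQ (n : ℕ) {a : ℕ} (t : Fin a → Fin (2 * n)) : Prop :=
  ∀ k l : Fin a, ((t k : ℕ) + 1 ≤ n) → ((t l : ℕ) + 1 = 2 * n + 1 - ((t k : ℕ) + 1)) →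
    (((t k : ℕ) + 1 : ℤ)) ≤ (n : ℤ) + (k : ℕ) - (l : ℕ)

/-- the column tableau sum: `tabSumQ n Q a v = T^{(a)}_1(v)` for `0 ≤ a ≤ n`, i.e.
`T^{(a)}_1(u + 1/2) = ∑ z_{i_1}(u + (a-1)/2) ⋯ z_{i_a}(u - (a-1)/2)` over strictly
increasing admissible tableaux. -/
def tabSumQ (n : ℕ) (Q : ℕ → ℂ → Kˣ) (a : ℕ) (v : ℂ) : K :=
  ∑ t ∈ univ.filter (fun t : Fin a → Fin (2 * n) => StrictMono t ∧ AdmQ n t),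
    ∏ k : Fin a,
      (zq n Q ((t k : ℕ) + 1) (v + ((a : ℂ) - 2 * (((k : ℕ) : ℂ) + 1)) / 2) : K)

/-- `T^{(a)}_1(v)` for all `a ∈ ℤ`: the fundamental `q`-characters for `1 ≤ a ≤ n`,
extended by `T^{(0)}_1 = 1`, `T^{(a)}_1 = 0` for `a < 0`, and
`T^{(a)}_1(u) + T^{(N-a)}_1(u) = 0`. -/
def T1q (n : ℕ) (Q : ℕ → ℂ → Kˣ) (a : ℤ) (v : ℂ) : K :=
  if a < 0 then 0
  else if a ≤ (n : ℤ) then tabSumQ n Q a.toNat v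
  else if a = (n : ℤ) + 1 then 0
  else if a ≤ 2 * (n : ℤ) + 2 then -tabSumQ n Q (2 * (n : ℤ) + 2 - a).toNat v
  else 0

/-- left-to-right composition of a list of difference operators. -/
def opProd (l : List ((ℂ → K) → (ℂ → K))) : (ℂ → K) → (ℂ → K) :=
  l.foldr (· ∘ ·) id

/-- the operator `L(u) = (M_{x_1(⋅+n)} - D)(M_{x_2(⋅+n-1)} - D) ⋯ (M_{x_N(⋅+n+1-N)} - D)`,
where `D` is the shift `(Df)(u) = f(u+1)` and `M_g` is multiplication by `g`. -/
def Lq (n : ℕ) (Q : ℕ → ℂ → Kˣ) : (ℂ → K) → (ℂ → K) :=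
  opProd ((List.range (2 * n + 2)).map fun j =>
    fun f u => xq n Q (j + 1) (u + (n : ℂ) - (j : ℂ)) * f u - f (u + 1))

/-- `ε_i = -1` for `i = n+1, n+2` and `= 1` otherwise. -/
def epsq (n : ℕ) (i : ℕ) : K := if i = n + 1 ∨ i = n + 2 then -1 else 1

/-- `L_j`, the left-to-right composition over `i = N+1-j, …, N` of the operators
`D - ε_i M_{x_i(⋅+n+1-i)}`. -/
def Ljq (n : ℕ) (Q : ℕ → ℂ → Kˣ) (j : ℕ) : (ℂ → K) → (ℂ → K) :=
  opProd ((List.range j).map fun r =>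
    fun f u => f (u + 1) -
      epsq n (2 * n + 3 - j + r) * xq n Q (2 * n + 3 - j + r)
        (u + (n : ℂ) + 1 - ((2 * n + 3 - j + r : ℕ) : ℂ)) * f u)

/-- the Casorati determinant `det_{1 ≤ r,s ≤ j} (w_r(u + s - 1))`
(for a family `w` indexed by `1, 2, …`). -/
def casq (w : ℕ → ℂ → K) (j : ℕ) (u : ℂ) : K :=
  Matrix.det (Matrix.of fun r s : Fin j => w ((r : ℕ) + 1) (u + ((s : ℕ) : ℂ)))

/-- `ξ^{(a)}_m(u)`: the determinant of the `N × N` matrix whose columns are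
`(w_j(u+c))_j` for `c` running over `(0, 1, …, a-1, a+m, a+m+1, …, N+m-1)`. -/
def xiq (n : ℕ) (w : ℕ → ℂ → K) (a m : ℕ) (u : ℂ) : K :=
  Matrix.det (Matrix.of fun j r : Fin (2 * n + 2) =>
    w ((j : ℕ) + 1) (u + ((if (r : ℕ) < a then (r : ℕ) else (r : ℕ) + m : ℕ) : ℂ)))

/-- the Young diagram `μ`: `μ_j = i_{N-j} + j - N` for `1 ≤ j ≤ N-1`
(and `μ_N = 0`, automatic since `i_0 = 0`). -/
def muRow (N : ℕ) (i : ℕ → ℕ) (j : ℕ) : ℕ := i (N - j) + j - N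

/-- the transpose `μ'` of the Young diagram `μ`: `μ'_j = #{1 ≤ r ≤ N-1 ∣ μ_r ≥ j}`. -/
def muTr (N : ℕ) (i : ℕ → ℕ) (j : ℕ) : ℕ :=
  ((Finset.Icc 1 (N - 1)).filter fun r => j ≤ muRow N i r).card

/-- the cells of the skew Young diagram `(μ_1^N)/μ`, in the coordinates of the
paper: `c = (α-1, β-1)` where the `α`-th row is counted from the bottom-left corner
of the rectangle `(μ_1^N)` and `β` is the column; the cell `(α,β)` belongs to the
skew shape iff `β > μ_{N+1-α}`. -/
def inShape (N : ℕ) (i : ℕ → ℕ) (m1 : ℕ) (c : Fin N × Fin m1) : Prop :=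
  muRow N i (N - (c.1 : ℕ)) ≤ (c.2 : ℕ)

/-- semistandardness of a filling of the skew shape `(μ_1^N)/μ` with entries in
`{1,…,N}` (encoded as `Fin N`): entries weakly increase along rows and strictly
increase along columns (downwards, i.e. as the row index `α` counted from the
bottom decreases). -/
def isSSYT (N : ℕ) (i : ℕ → ℕ) (m1 : ℕ)
    (t : {c : Fin N × Fin m1 // inShape N i m1 c} → Fin N) : Prop :=
  (∀ c c' : {c : Fin N × Fin m1 // inShape N i m1 c},
      (c.1.1 : ℕ) = (c'.1.1 : ℕ) → (c.1.2 : ℕ) + 1 = (c'.1.2 : ℕ) → t c ≤ t c') ∧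
  (∀ c c' : {c : Fin N × Fin m1 // inShape N i m1 c},
      (c.1.1 : ℕ) = (c'.1.1 : ℕ) + 1 → (c.1.2 : ℕ) = (c'.1.2 : ℕ) → t c < t c')

/-- the first order difference operator `D - M_a`. -/
def diffOp (a : ℂ → K) (f : ℂ → K) : ℂ → K := fun u => f (u + 1) - a u * f u

/-- the composition `(D - M_{a 0}) (D - M_{a 1}) ⋯ (D - M_{a (k-1)})`. -/
def seqOp : (ℕ → ℂ → K) → ℕ → (ℂ → K) → ℂ → K
  | _, 0, f => f
  | a, k + 1, f => diffOp (a 0) (seqOp (fun i => a (i + 1)) k f)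

theorem seqOp_succ_last (a : ℕ → ℂ → K) (k : ℕ) (f : ℂ → K) :
    seqOp a (k + 1) f = seqOp a k (diffOp (a k) f) := by
  induction k generalizing a with
  | zero => rfl
  | succ k ih =>
    change diffOp (a 0) (seqOp (fun i => a (i + 1)) (k + 1) f) = _
    rw [ih]
    rfl

theorem opProd_map_range (a : ℕ → ℂ → K) (k : ℕ) :
    opProd ((List.range k).map fun r => diffOp (a r)) = seqOp a k := by
  induction k generalizing a with
  | zero => rfl
  | succ k ih =>
    funext f
    have := ih (fun i => a (i + 1))
    rw [List.range_succ_eq_map, List.map_cons, List.map_map]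
    change diffOp (a 0) (opProd ((List.range k).map fun r => diffOp (a (r + 1))) f) = _
    rw [this]
    rfl

/-- the operator obtained from `D² - M_{η₀(u)/η₀(u+1)}` by multiplying successively by
`D - M_{η_r(u+r+1)/η_{r+1}(u+r+2)}` on the left and by `D - M_{η_{r+1}(u)/η_r(u)}` on the
right. -/
def sandOp (η : ℕ → ℂ → Kˣ) : ℕ → (ℂ → K) → ℂ → K
  | 0, f => fun u => f (u + 2) - ((η 0 u * (η 0 (u + 1))⁻¹ : Kˣ) : K) * f u
  | r + 1, f =>
      diffOp (fun u => ((η r (u + r + 1) * (η (r + 1) (u + r + 2))⁻¹ : Kˣ) : K))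
        (sandOp η r (diffOp (fun u => ((η (r + 1) u * (η r u)⁻¹ : Kˣ) : K)) f))

/-- the `a`-th coefficient of `sandOp η r`, up to sign and a shift of the argument. -/
def sandCoeff (η : ℕ → ℂ → Kˣ) : ℕ → ℤ → ℂ → K
  | 0, a, v => if a = 0 then 1 else if a = 2 then -((η 0 v * (η 0 (v + 1))⁻¹ : Kˣ) : K) else 0
  | r + 1, a, v =>
      sandCoeff η r a v
      + ((η r v * (η (r + 1) (v + 1))⁻¹ : Kˣ) : K) * sandCoeff η r (a - 1) (v - 1)
      + sandCoeff η r (a - 1) v *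
          ((η (r + 1) (v - a + r + 3) * (η r (v - a + r + 3))⁻¹ : Kˣ) : K)
      + ((η r v * (η (r + 1) (v + 1))⁻¹ : Kˣ) : K) * sandCoeff η r (a - 2) (v - 1) *
          ((η (r + 1) (v - a + r + 3) * (η r (v - a + r + 3))⁻¹ : Kˣ) : K)

theorem sandCoeff_of_neg (η : ℕ → ℂ → Kˣ) (r : ℕ) (a : ℤ) (v : ℂ) (ha : a < 0) :
    sandCoeff η r a v = 0 := by
  induction r generalizing a v with
  | zero => rw [sandCoeff, if_neg (by lia), if_neg (by lia)]
  | succ r ih =>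
    rw [sandCoeff, ih a v ha, ih (a - 1) _ (by lia), ih (a - 1) _ (by lia), ih (a - 2) _ (by lia)]
    ring

theorem sandCoeff_of_gt (η : ℕ → ℂ → Kˣ) (r : ℕ) (a : ℤ) (v : ℂ) (ha : 2 * (r : ℤ) + 2 < a) :
    sandCoeff η r a v = 0 := by
  induction r generalizing a v with
  | zero => rw [sandCoeff, if_neg (by lia), if_neg (by lia)]
  | succ r ih =>
    rw [sandCoeff, ih a v (by lia), ih (a - 1) _ (by lia), ih (a - 1) _ (by lia),
      ih (a - 2) _ (by lia)]
    ring

theorem sandOp_eq_sum (η : ℕ → ℂ → Kˣ) (r : ℕ) (f : ℂ → K) (v : ℂ) :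
    sandOp η r f v = ∑ a ∈ range (2 * r + 3),
      (-1) ^ a * sandCoeff η r a (v + r) * f (v + 2 * r + 2 - a) := by
  induction r generalizing f v with
  | zero =>
    simp [sandOp, sum_range_succ, sandCoeff]
    ring
  | succ r ih =>
    have h1 : ∀ X : ℕ → K, ∑ a ∈ range (2 * (r + 1) + 3), sandCoeff η r a (v + r + 1) * X a =
        ∑ a ∈ range (2 * r + 3), sandCoeff η r a (v + r + 1) * X a := by
      intro X
      rw [show 2 * (r + 1) + 3 = 2 * r + 3 + 1 + 1 by ring, sum_range_succ, sum_range_succ,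
        sandCoeff_of_gt, sandCoeff_of_gt] <;> [simp; (push_cast; lia); (push_cast; lia)]
    have h2 : ∀ (X : ℕ → K) (w : ℂ), ∑ a ∈ range (2 * (r + 1) + 3),
        sandCoeff η r ((a : ℤ) - 1) w * X a =
        ∑ a ∈ range (2 * r + 3), sandCoeff η r a w * X (a + 1) := by
      intro X w
      rw [show 2 * (r + 1) + 3 = 2 * r + 3 + 1 + 1 by ring, sum_range_succ', sum_range_succ,
        sandCoeff_of_gt _ _ _ _ (by push_cast; lia), sandCoeff_of_neg _ _ _ _ (by simp)]
      simp
    have h3 : ∀ (X : ℕ → K) (w : ℂ), ∑ a ∈ range (2 * (r + 1) + 3),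
        sandCoeff η r ((a : ℤ) - 2) w * X a =
        ∑ a ∈ range (2 * r + 3), sandCoeff η r a w * X (a + 2) := by
      intro X w
      rw [show 2 * (r + 1) + 3 = 2 * r + 3 + 1 + 1 by ring, sum_range_succ', sum_range_succ',
        sandCoeff_of_neg _ _ _ _ (by simp), sandCoeff_of_neg _ _ _ _ (by simp)]
      simp only [zero_mul, add_zero]
      refine sum_congr rfl fun a _ => ?_
      congr 2
      push_cast; ring
    set Z : K := ((η r (v + r + 1) * (η (r + 1) (v + r + 2))⁻¹ : Kˣ) : K) with hZ
    have hL : sandOp η (r + 1) f v =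
        ∑ a ∈ range (2 * r + 3), (-1) ^ a * sandCoeff η r a (v + r + 1) *
          (f (v + 2 * r + 4 - a) - ((η (r + 1) (v + 2 * r + 3 - a) *
            (η r (v + 2 * r + 3 - a))⁻¹ : Kˣ) : K) * f (v + 2 * r + 3 - a)) -
        Z * ∑ a ∈ range (2 * r + 3), (-1) ^ a * sandCoeff η r a (v + r) *
          (f (v + 2 * r + 3 - a) - ((η (r + 1) (v + 2 * r + 2 - a) *
            (η r (v + 2 * r + 2 - a))⁻¹ : Kˣ) : K) * f (v + 2 * r + 2 - a)) := by
      rw [sandOp, diffOp, ih, ih]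
      simp only [diffOp]
      congr 1
      · refine sum_congr rfl fun a _ => ?_
        rw [show v + 1 + (r : ℂ) = v + r + 1 by ring,
          show v + 1 + 2 * (r : ℂ) + 2 - a = v + 2 * r + 3 - a by ring,
          show v + 2 * (r : ℂ) + 3 - a + 1 = v + 2 * r + 4 - a by ring]
      · congr 1
        refine sum_congr rfl fun a _ => ?_
        rw [show v + 2 * (r : ℂ) + 2 - a + 1 = v + 2 * r + 3 - a by ring]
    have hR : ∀ a : ℕ, (-1 : K) ^ a * sandCoeff η (r + 1) a (v + (r + 1 : ℕ)) *
          f (v + 2 * (r + 1 : ℕ) + 2 - a) =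
        sandCoeff η r a (v + r + 1) * ((-1) ^ a * f (v + 2 * r + 4 - a)) +
        sandCoeff η r ((a : ℤ) - 1) (v + r) * ((-1) ^ a * Z * f (v + 2 * r + 4 - a)) +
        sandCoeff η r ((a : ℤ) - 1) (v + r + 1) * ((-1) ^ a *
          ((η (r + 1) (v + 2 * r + 4 - a) * (η r (v + 2 * r + 4 - a))⁻¹ : Kˣ) : K) *
            f (v + 2 * r + 4 - a)) +
        sandCoeff η r ((a : ℤ) - 2) (v + r) * ((-1) ^ a * Z *
          ((η (r + 1) (v + 2 * r + 4 - a) * (η r (v + 2 * r + 4 - a))⁻¹ : Kˣ) : K) *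
            f (v + 2 * r + 4 - a)) := by
      intro a
      rw [sandCoeff]
      push_cast
      rw [show v + ((r : ℂ) + 1) = v + r + 1 by ring,
        show v + (r : ℂ) + 1 + 1 = v + r + 2 by ring,
        show v + (r : ℂ) + 1 - 1 = v + r by ring,
        show v + (r : ℂ) + 1 - a + r + 3 = v + 2 * r + 4 - a by ring,
        show v + 2 * ((r : ℂ) + 1) + 2 - a = v + 2 * r + 4 - a by ring, hZ]
      push_cast
      ring
    rw [hL, sum_congr rfl fun a _ => hR a, sum_add_distrib, sum_add_distrib, sum_add_distrib,
      h1, h2, h2, h3, mul_sum, ← sum_sub_distrib, ← sum_add_distrib, ← sum_add_distrib,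
      ← sum_add_distrib]
    refine sum_congr rfl fun a _ => ?_
    push_cast
    rw [show v + 2 * (r : ℂ) + 4 - (a + 1) = v + 2 * r + 3 - a by ring,
      show v + 2 * (r : ℂ) + 4 - (a + 2) = v + 2 * r + 2 - a by ring]
    ring

theorem sandCoeff_symm (η : ℕ → ℂ → Kˣ) (r : ℕ) (a : ℤ) (v : ℂ) :
    sandCoeff η r (2 * r + 2 - a) v =
      -(((η r (v - r + a) * (η r (v + 1))⁻¹ : Kˣ) : K) * sandCoeff η r a (v + a - r - 1)) := by
  induction r generalizing a v with
  | zero =>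
    by_cases h0 : a = 0
    · subst h0; simp [sandCoeff]
    by_cases h2 : a = 2
    · subst h2
      simp only [sandCoeff]
      norm_num
      rw [show v + 2 - 1 = v + 1 by ring]
      rw [← Units.val_mul, ← Units.val_mul, ← Units.val_mul]
      simp
    · rw [sandCoeff, sandCoeff, if_neg (by lia), if_neg (by lia), if_neg (by lia), if_neg (by lia)]
      simp
  | succ r ih =>
    have e1 := ih (a - 2) v
    have e2 := ih (a - 1) (v - 1)
    have e3 := ih (a - 1) v
    have e4 := ih a (v - 1)
    rw [sandCoeff, sandCoeff]
    rw [show 2 * ((r + 1 : ℕ) : ℤ) + 2 - a = 2 * r + 2 - (a - 2) by push_cast; ring, e1,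
      show 2 * (r : ℤ) + 2 - (a - 2) - 1 = 2 * r + 2 - (a - 1) by ring, e2, e3,
      show 2 * (r : ℤ) + 2 - (a - 2) - 2 = 2 * r + 2 - a by ring, e4]
    push_cast
    rw [show v + (a - 2 : ℂ) - r - 1 = v + a - r - 3 by ring,
      show v - 1 + (a - 1 : ℂ) - r - 1 = v + a - r - 3 by ring,
      show v + (a - 1 : ℂ) - r - 1 = v + a - r - 2 by ring,
      show v - 1 + (a : ℂ) - r - 1 = v + a - r - 2 by ring,
      show v + (a : ℂ) - (r + 1) - 1 = v + a - r - 2 by ring,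
      show v + (a : ℂ) - r - 2 - 1 = v + a - r - 3 by ring,
      show v - (r : ℂ) + (a - 2) = v + a - r - 2 by ring,
      show v - 1 - (r : ℂ) + (a - 1) = v + a - r - 2 by ring,
      show v - (r : ℂ) + (a - 1) = v + a - r - 1 by ring,
      show v - 1 - (r : ℂ) + a = v + a - r - 1 by ring,
      show v - ((r : ℂ) + 1) + a = v + a - r - 1 by ring,
      show v + (a : ℂ) - r - 2 + 1 = v + a - r - 1 by ring,
      show v + (a : ℂ) - r - 2 - a + r + 3 = v + 1 by ring,
      show v - (2 * (r : ℂ) + 2 - (a - 2)) + r + 3 = v + a - r - 1 by ring,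
      show v - 1 + 1 = v by ring]
    generalize v + (a : ℂ) - r - 1 = p
    generalize v + (a : ℂ) - r - 2 = q
    generalize sandCoeff η r (a - 2) (v + a - r - 3) = s2
    generalize sandCoeff η r (a - 1) (v + a - r - 3) = s1
    generalize sandCoeff η r (a - 1) q = s1'
    generalize sandCoeff η r a q = s0
    have hu : ∀ x : Kˣ, (x : K) * ((x⁻¹ : Kˣ) : K) = 1 := fun x => x.mul_inv
    have h1 := hu (η (r + 1) p)
    have h2 := hu (η r p)
    have h3 := hu (η (r + 1) (v + 1))
    have h4 := hu (η r v)
    grind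

theorem sandCoeff_middle (η : ℕ → ℂ → Kˣ) (r : ℕ) (v : ℂ) :
    sandCoeff η r (r + 1) v = 0 := by
  induction r generalizing v with
  | zero => simp [sandCoeff]
  | succ r ih =>
    have h := sandCoeff_symm η r r v
    rw [show 2 * (r : ℤ) + 2 - r = r + 2 by ring] at h
    rw [sandCoeff, show ((r + 1 : ℕ) : ℤ) + 1 = r + 2 by push_cast; ring, h,
      show (r : ℤ) + 2 - 1 = r + 1 by ring, ih, ih, show (r : ℤ) + 2 - 2 = r by ring]
    push_cast
    rw [show v - (r : ℂ) + r = v by ring, show v + (r : ℂ) - r - 1 = v - 1 by ring,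
      show v - ((r : ℂ) + 2) + r + 3 = v + 1 by ring]
    have h3 := (η (r + 1) (v + 1)).mul_inv
    grind

/-- the shifted `Y`-variable `Y_{n-r}(v + (n-r)/2)`. -/
def etaq (n : ℕ) (Q : ℕ → ℂ → Kˣ) (r : ℕ) (v : ℂ) : Kˣ :=
  Yq n Q (n - r) (v + ((n - r : ℕ) : ℂ) / 2)

theorem etaq_self (n : ℕ) (Q : ℕ → ℂ → Kˣ) (v : ℂ) : etaq n Q n v = 1 := by
  simp [etaq, Yq]

theorem zq_sub (n : ℕ) (Q : ℕ → ℂ → Kˣ) (r : ℕ) (hr : r < n) (v : ℂ) :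
    zq n Q (n - r) v = etaq n Q r v * (etaq n Q (r + 1) (v + 1))⁻¹ := by
  rw [zq, if_pos (by lia), etaq, etaq, show n - r - 1 = n - (r + 1) by lia]
  congr 3
  rw [Nat.cast_sub (by lia), Nat.cast_sub (by lia)]
  push_cast; ring

theorem zq_add (n : ℕ) (Q : ℕ → ℂ → Kˣ) (r : ℕ) (hr : r < n) (v : ℂ) :
    zq n Q (n + r + 1) v =
      etaq n Q (r + 1) (v + r + 2) * (etaq n Q r (v + r + 2))⁻¹ := by
  rw [zq, if_neg (by lia), etaq, etaq, show 2 * n - (n + r + 1) = n - (r + 1) by lia,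
    show 2 * n + 1 - (n + r + 1) = n - r by lia]
  congr 2
  · rw [Nat.cast_sub (by lia)]
    push_cast; ring
  · congr 1
    rw [Nat.cast_sub (by lia)]
    push_cast; ring

/-- the weight of a column with (`0`-based) set of letters `s`, read from the top at `v`. -/
def setWeight (n : ℕ) (Q : ℕ → ℂ → Kˣ) (s : Finset ℕ) (v : ℂ) : K :=
  ∏ i ∈ s, (zq n Q (i + 1) (v - (#{j ∈ s | j < i} : ℂ)) : K)

/-- admissibility in terms of the set of letters of a column. -/
def AdmSet (n : ℕ) (s : Finset ℕ) : Prop :=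
  ∀ d ∈ s, d < n → 2 * n - 1 - d ∈ s → #{j ∈ s | d ≤ j ∧ j < 2 * n - 1 - d} + d + 1 ≤ n

/-- the sum over admissible columns of height `a` in the `2r` innermost letters. -/
def colSum (n : ℕ) (Q : ℕ → ℂ → Kˣ) (r : ℕ) (a : ℤ) (v : ℂ) : K :=
  ∑ s ∈ (Ico (n - r) (n + r)).powerset,
    if AdmSet n s ∧ (#s : ℤ) = a then setWeight n Q s v else 0

theorem setWeight_insert_bot (n : ℕ) (Q : ℕ → ℂ → Kˣ) (s : Finset ℕ) (m : ℕ)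
    (hm : ∀ i ∈ s, m < i) (v : ℂ) :
    setWeight n Q (insert m s) v = zq n Q (m + 1) v * setWeight n Q s (v - 1) := by
  have hms : m ∉ s := fun h => (hm m h).false
  rw [setWeight, prod_insert hms, setWeight]
  congr 1
  · rw [filter_false_of_mem]
    · simp
    · intro x hx
      rcases mem_insert.1 hx with rfl | hx
      · simp
      · exact (hm x hx).not_gt
  · refine prod_congr rfl fun i hi => ?_
    rw [filter_insert, if_pos (hm i hi), card_insert_of_notMem (by simp [hms])]
    push_cast
    congr 2; ring

theorem setWeight_insert_top (n : ℕ) (Q : ℕ → ℂ → Kˣ) (s : Finset ℕ) (m : ℕ)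
    (hm : ∀ i ∈ s, i < m) (v : ℂ) :
    setWeight n Q (insert m s) v = setWeight n Q s v * zq n Q (m + 1) (v - #s) := by
  have hms : m ∉ s := fun h => (hm m h).false
  rw [setWeight, prod_insert hms, setWeight, mul_comm]
  congr 1
  · refine prod_congr rfl fun i hi => ?_
    rw [filter_insert, if_neg (hm i hi).not_gt]
  · rw [filter_insert, if_neg (lt_irrefl _), filter_true_of_mem hm]

theorem filter_between_eq (n r d : ℕ) (s s' : Finset ℕ) (hd : n - r ≤ d)
    (hss : ∀ j ∈ Ico (n - r) (n + r), j ∈ s ↔ j ∈ s') :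
    ({j ∈ s | d ≤ j ∧ j < 2 * n - 1 - d} : Finset ℕ) =
      {j ∈ s' | d ≤ j ∧ j < 2 * n - 1 - d} := by
  ext j
  simp only [mem_filter, mem_Ico] at *
  constructor <;> rintro ⟨h1, h2⟩ <;> refine ⟨?_, h2⟩
  · exact (hss j (by lia)).1 h1
  · exact (hss j (by lia)).2 h1

theorem admSet_of_eq_inside (n r : ℕ) (s s' : Finset ℕ)
    (hs' : s' ⊆ Ico (n - r) (n + r))
    (hss : ∀ j ∈ Ico (n - r) (n + r), j ∈ s ↔ j ∈ s') (h : AdmSet n s) : AdmSet n s' := by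
  intro d hd hdn hd'
  have h1 := hs' hd
  have h2 := hs' hd'
  rw [← filter_between_eq n r d s s' (mem_Ico.1 h1).1 hss]
  exact h d ((hss d h1).2 hd) hdn ((hss _ h2).2 hd')

theorem admSet_insert_iff (n r : ℕ) (s t : Finset ℕ) (hr : r < n)
    (hs : s ⊆ Ico (n - r) (n + r)) (hst : s ⊆ t)
    (hss : ∀ j ∈ t, j ∈ s ∨ j = n - r - 1 ∨ j = n + r) :
    AdmSet n t ↔ AdmSet n s ∧ (n - r - 1 ∈ t → n + r ∈ t → #s + 1 ≤ r) := by
  have hin : ∀ j ∈ Ico (n - r) (n + r), j ∈ t ↔ j ∈ s := by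
    intro j hj
    rw [mem_Ico] at hj
    refine ⟨fun h => ?_, fun h => hst h⟩
    rcases hss j h with h | h | h
    · exact h
    · lia
    · lia
  have hcard : n - r - 1 ∈ t → #{j ∈ t | n - r - 1 ≤ j ∧ j < 2 * n - 1 - (n - r - 1)} = #s + 1 := by
    intro hlo
    rw [← card_insert_of_notMem (s := s) (a := n - r - 1)
      (fun h => by have := mem_Ico.1 (hs h); lia)]
    congr 1
    ext j
    simp only [mem_filter, mem_insert]
    constructor
    · rintro ⟨h1, h2, h3⟩
      rcases hss j h1 with h | h | h
      · exact Or.inr h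
      · exact Or.inl h
      · lia
    · rintro (rfl | h)
      · exact ⟨hlo, by lia⟩
      · have := mem_Ico.1 (hs h)
        exact ⟨hst h, by lia⟩
  constructor
  · intro h
    refine ⟨admSet_of_eq_inside n r t s hs hin h, fun hlo hhi => ?_⟩
    have := h (n - r - 1) hlo (by lia) (by rwa [show 2 * n - 1 - (n - r - 1) = n + r by lia])
    rw [hcard hlo] at this
    lia
  · rintro ⟨h, h'⟩ d hd hdn hd'
    rcases hss d hd with hds | rfl | rfl
    · have h1 := hs hds
      rw [filter_between_eq n r d t s (mem_Ico.1 h1).1 hin]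
      refine h d hds hdn ((hin _ ?_).1 hd')
      rw [mem_Ico] at h1 ⊢
      lia
    · rw [hcard hd]
      have := h' hd (by rwa [show 2 * n - 1 - (n - r - 1) = n + r by lia] at hd')
      lia
    · lia

theorem card_le_of_admSet (n r : ℕ) (hr : r ≤ n) (s : Finset ℕ)
    (hs : s ⊆ Ico (n - r) (n + r)) (h : AdmSet n s) : #s ≤ r := by
  induction r generalizing s with
  | zero => simp at hs; simp [hs]
  | succ r ih =>
    set s' := s ∩ Ico (n - r) (n + r) with hs'
    have hsub : ∀ j ∈ s, j ∈ s' ∨ j = n - r - 1 ∨ j = n + r := by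
      intro j hj
      have := mem_Ico.1 (hs hj)
      simp only [hs', mem_inter, hj, true_and, mem_Ico]
      lia
    have hadm := (admSet_insert_iff n r s' s (by lia) inter_subset_right inter_subset_left
      hsub).1 h
    have hle := ih (by lia) s' inter_subset_right hadm.1
    by_cases hlo : n - r - 1 ∈ s
    · by_cases hhi : n + r ∈ s
      · have h1 := hadm.2 hlo hhi
        have h2 : s ⊆ insert (n - r - 1) (insert (n + r) s') := fun j hj => by
          rcases hsub j hj with h | h | h <;> simp [h]
        have h3 := card_le_card h2
        have h4 := card_insert_le (n - r - 1) (insert (n + r) s')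
        have h5 := card_insert_le (n + r) s'
        lia
      · have h2 : s ⊆ insert (n - r - 1) s' := fun j hj => by
          rcases hsub j hj with h | h | h
          · simp [h]
          · simp [h]
          · exact absurd (h ▸ hj) hhi
        have h3 := card_le_card h2
        have h4 := card_insert_le (n - r - 1) s'
        lia
    · have h2 : s ⊆ insert (n + r) s' := fun j hj => by
        rcases hsub j hj with h | h | h
        · simp [h]
        · exact absurd (h ▸ hj) hlo
        · simp [h]
      have h3 := card_le_card h2
      have h4 := card_insert_le (n + r) s'
      lia

theorem colSum_eq_zero (n : ℕ) (Q : ℕ → ℂ → Kˣ) (r : ℕ) (hr : r ≤ n) (a : ℤ) (v : ℂ)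
    (ha : (r : ℤ) < a) : colSum n Q r a v = 0 := by
  refine sum_eq_zero fun s hs => if_neg ?_
  rintro ⟨h, rfl⟩
  have := card_le_of_admSet n r hr s (mem_powerset.1 hs) h
  lia

theorem colSum_succ (n : ℕ) (Q : ℕ → ℂ → Kˣ) (r : ℕ) (hr : r < n) (a : ℤ) (v : ℂ)
    (ha : a ≤ r + 1) :
    colSum n Q (r + 1) a v = colSum n Q r a v
      + zq n Q (n - r) v * colSum n Q r (a - 1) (v - 1)
      + colSum n Q r (a - 1) v * zq n Q (n + r + 1) (v - a + 1)
      + zq n Q (n - r) v * colSum n Q r (a - 2) (v - 1) * zq n Q (n + r + 1) (v - a + 1) := by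
  have hI : Ico (n - (r + 1)) (n + (r + 1)) =
      insert (n - r - 1) (insert (n + r) (Ico (n - r) (n + r))) := by
    ext j; simp only [mem_insert, mem_Ico]; lia
  rw [colSum, hI, sum_powerset_insert (by simp; lia), sum_powerset_insert (by simp),
    sum_powerset_insert (by simp)]
  have hsub : ∀ s ∈ (Ico (n - r) (n + r)).powerset, s ⊆ Ico (n - r) (n + r) :=
    fun s hs => mem_powerset.1 hs
  have key : ∀ s ∈ (Ico (n - r) (n + r)).powerset,
      (∀ i ∈ s, n - r - 1 < i) ∧ (∀ i ∈ s, i < n + r) ∧ n - r - 1 ∉ s ∧ n + r ∉ s ∧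
      (∀ i ∈ insert (n + r) s, n - r - 1 < i) := by
    intro s hs
    have h := hsub s hs
    have h1 : ∀ i ∈ s, n - r - 1 < i := fun i hi => by have := mem_Ico.1 (h hi); lia
    have h2 : ∀ i ∈ s, i < n + r := fun i hi => by have := mem_Ico.1 (h hi); lia
    refine ⟨h1, h2, fun h => (h1 _ h).false, fun h => (h2 _ h).false, fun i hi => ?_⟩
    rcases mem_insert.1 hi with rfl | hi
    · lia
    · exact h1 i hi
  have t1 : ∑ s ∈ (Ico (n - r) (n + r)).powerset,
      (if AdmSet n (insert (n + r) s) ∧ (#(insert (n + r) s) : ℤ) = a then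
        setWeight n Q (insert (n + r) s) v else 0) =
      colSum n Q r (a - 1) v * zq n Q (n + r + 1) (v - a + 1) := by
    rw [colSum, sum_mul]
    refine sum_congr rfl fun s hs => ?_
    obtain ⟨k1, k2, k3, k4, k5⟩ := key s hs
    rw [setWeight_insert_top n Q s _ k2, card_insert_of_notMem k4,
      admSet_insert_iff n r s _ hr (hsub s hs) (subset_insert _ _)
        (fun j hj => by rcases mem_insert.1 hj with h | h <;> simp [h])]
    have : n - r - 1 ∉ insert (n + r) s := fun h => (k5 _ h).false
    by_cases hc : AdmSet n s ∧ (#s : ℤ) = a - 1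
    · rw [if_pos hc, if_pos ⟨⟨hc.1, fun h => absurd h this⟩, by push_cast; lia⟩]
      have : (a : ℂ) = #s + 1 := by
        have := congrArg (Int.cast : ℤ → ℂ) hc.2
        push_cast at this
        rw [this]; ring
      rw [this, show v - ((#s : ℂ) + 1) + 1 = v - #s by ring]
    · rw [if_neg hc, zero_mul, if_neg]
      rintro ⟨h1, h2⟩
      exact hc ⟨h1.1, by push_cast at h2; lia⟩
  have t2 : ∑ s ∈ (Ico (n - r) (n + r)).powerset,
      (if AdmSet n (insert (n - r - 1) s) ∧ (#(insert (n - r - 1) s) : ℤ) = a then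
        setWeight n Q (insert (n - r - 1) s) v else 0) =
      zq n Q (n - r) v * colSum n Q r (a - 1) (v - 1) := by
    rw [colSum, mul_sum]
    refine sum_congr rfl fun s hs => ?_
    obtain ⟨k1, k2, k3, k4, k5⟩ := key s hs
    rw [setWeight_insert_bot n Q s _ k1, card_insert_of_notMem k3,
      show n - r - 1 + 1 = n - r by lia,
      admSet_insert_iff n r s _ hr (hsub s hs) (subset_insert _ _)
        (fun j hj => by rcases mem_insert.1 hj with h | h <;> simp [h])]
    have : n + r ∉ insert (n - r - 1) s := fun h => by
      rcases mem_insert.1 h with h | h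
      · lia
      · exact k4 h
    by_cases hc : AdmSet n s ∧ (#s : ℤ) = a - 1
    · rw [if_pos hc, if_pos ⟨⟨hc.1, fun _ h => absurd h this⟩, by push_cast; lia⟩]
    · rw [if_neg hc, mul_zero, if_neg]
      rintro ⟨h1, h2⟩
      exact hc ⟨h1.1, by push_cast at h2; lia⟩
  have t3 : ∑ s ∈ (Ico (n - r) (n + r)).powerset,
      (if AdmSet n (insert (n - r - 1) (insert (n + r) s)) ∧
          (#(insert (n - r - 1) (insert (n + r) s)) : ℤ) = a then
        setWeight n Q (insert (n - r - 1) (insert (n + r) s)) v else 0) =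
      zq n Q (n - r) v * colSum n Q r (a - 2) (v - 1) * zq n Q (n + r + 1) (v - a + 1) := by
    rw [colSum, mul_sum, sum_mul]
    refine sum_congr rfl fun s hs => ?_
    obtain ⟨k1, k2, k3, k4, k5⟩ := key s hs
    rw [setWeight_insert_bot n Q _ _ k5, setWeight_insert_top n Q s _ k2,
      card_insert_of_notMem (fun h => (k5 _ h).false), card_insert_of_notMem k4,
      show n - r - 1 + 1 = n - r by lia,
      admSet_insert_iff n r s _ hr (hsub s hs)
        ((subset_insert _ _).trans (subset_insert _ _))
        (fun j hj => by
          rcases mem_insert.1 hj with h | h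
          · simp [h]
          · rcases mem_insert.1 h with h | h <;> simp [h])]
    by_cases hc : AdmSet n s ∧ (#s : ℤ) = a - 2
    · rw [if_pos hc, if_pos ⟨⟨hc.1, fun _ _ => by lia⟩, by push_cast; lia⟩]
      have : (a : ℂ) = #s + 2 := by
        have := congrArg (Int.cast : ℤ → ℂ) hc.2
        push_cast at this
        rw [this]; ring
      rw [this, show v - ((#s : ℂ) + 2) + 1 = v - 1 - #s by ring]
      ring
    · rw [if_neg hc, mul_zero, zero_mul, if_neg]
      rintro ⟨h1, h2⟩
      exact hc ⟨h1.1, by push_cast at h2; lia⟩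
  rw [t1, t2, t3, ← colSum]
  ring

theorem colSum_eq_sandCoeff (n : ℕ) (Q : ℕ → ℂ → Kˣ) (r : ℕ) (hr : r ≤ n) (a : ℤ) (v : ℂ)
    (ha : a ≤ r + 1) : colSum n Q r a v = sandCoeff (etaq n Q) r a v := by
  induction r generalizing a v with
  | zero =>
    have hadm : AdmSet n ∅ := by intro d hd; simp at hd
    rw [sandCoeff, if_neg (c := a = 2) (by push_cast at ha; lia)]
    simp [colSum, hadm, setWeight, eq_comm]
  | succ r ih =>
    by_cases h : a ≤ r + 1
    · rw [colSum_succ n Q r (by lia) a v h, ih (by lia) _ _ h, ih (by lia) _ _ (by lia),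
        ih (by lia) _ _ (by lia), ih (by lia) _ _ (by lia), sandCoeff, zq_sub n Q r (by lia),
        zq_add n Q r (by lia), show v - (a : ℂ) + 1 + r + 2 = v - a + r + 3 by ring]
    · have : a = ((r + 1 : ℕ) : ℤ) + 1 := by push_cast at ha ⊢; lia
      rw [colSum_eq_zero n Q (r + 1) hr a v (by lia), this, sandCoeff_middle]

theorem card_image_filter_lt {a m : ℕ} (t : Fin a → Fin m) (ht : StrictMono t) (k : Fin a) :
    #{j ∈ univ.image (fun k => (t k : ℕ)) | j < (t k : ℕ)} = (k : ℕ) := by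
  have : ({j ∈ univ.image (fun k => (t k : ℕ)) | j < (t k : ℕ)} : Finset ℕ) =
      (Iio k).image (fun k => (t k : ℕ)) := by
    ext j
    simp only [mem_filter, mem_image, mem_univ, true_and, mem_Iio]
    constructor
    · rintro ⟨⟨l, rfl⟩, h⟩
      exact ⟨l, ht.lt_iff_lt.1 (Fin.lt_def.2 h), rfl⟩
    · rintro ⟨l, h, rfl⟩
      exact ⟨⟨l, rfl⟩, Fin.lt_def.1 (ht h)⟩
  rw [this, card_image_of_injective _ (fun _ _ h => ht.injective (Fin.val_injective h))]
  simp

theorem card_image_filter_between {a m : ℕ} (t : Fin a → Fin m) (ht : StrictMono t)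
    (k l : Fin a) :
    #{j ∈ univ.image (fun k => (t k : ℕ)) | (t k : ℕ) ≤ j ∧ j < (t l : ℕ)} =
      (l : ℕ) - (k : ℕ) := by
  have : ({j ∈ univ.image (fun k => (t k : ℕ)) | (t k : ℕ) ≤ j ∧ j < (t l : ℕ)} : Finset ℕ) =
      (Ico k l).image (fun k => (t k : ℕ)) := by
    ext j
    simp only [mem_filter, mem_image, mem_univ, true_and, mem_Ico]
    constructor
    · rintro ⟨⟨i, rfl⟩, h1, h2⟩
      exact ⟨i, ⟨ht.le_iff_le.1 (Fin.le_def.2 h1), ht.lt_iff_lt.1 (Fin.lt_def.2 h2)⟩, rfl⟩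
    · rintro ⟨i, ⟨h1, h2⟩, rfl⟩
      exact ⟨⟨i, rfl⟩, Fin.le_def.1 (ht.monotone h1), Fin.lt_def.1 (ht h2)⟩
  rw [this, card_image_of_injective _ (fun _ _ h => ht.injective (Fin.val_injective h))]
  simp

theorem admQ_iff_admSet_image (n : ℕ) {a : ℕ} (t : Fin a → Fin (2 * n)) (ht : StrictMono t) :
    AdmQ n t ↔ AdmSet n (univ.image fun k => (t k : ℕ)) := by
  constructor
  · intro h d hd hdn hd'
    obtain ⟨k, -, rfl⟩ := mem_image.1 hd
    obtain ⟨l, -, hl⟩ := mem_image.1 hd'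
    simp only [← hl]
    rw [card_image_filter_between t ht k l]
    have := h k l (by lia) (by lia)
    have hkl : (k : ℕ) < l := ht.lt_iff_lt.1 (Fin.lt_def.2 (by lia))
    lia
  · intro h k l hk hl
    have hl' : 2 * n - 1 - (t k : ℕ) = t l := by lia
    have := h (t k) (by simp) (by lia) (by rw [hl']; simp)
    rw [hl', card_image_filter_between t ht k l] at this
    lia

theorem tabSumQ_eq_colSum (n : ℕ) (Q : ℕ → ℂ → Kˣ) (a : ℕ) (v : ℂ) :
    tabSumQ n Q a v = colSum n Q n a (v + (a : ℂ) / 2 - 1) := by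
  rw [tabSumQ, colSum, ← sum_filter]
  refine sum_bij (fun t _ => univ.image fun k => (t k : ℕ)) ?_ ?_ ?_ ?_
  · intro t ht
    obtain ⟨ht, hadm⟩ := (mem_filter.1 ht).2
    rw [mem_filter, mem_powerset]
    refine ⟨fun j hj => ?_, (admQ_iff_admSet_image n t ht).1 hadm, ?_⟩
    · obtain ⟨k, -, rfl⟩ := mem_image.1 hj
      rw [mem_Ico]
      have := (t k).2
      lia
    · rw [card_image_of_injective _ (fun _ _ h => ht.injective (Fin.val_injective h))]
      simp
  · intro t ht t' ht' h
    have hm := (mem_filter.1 ht).2.1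
    have hm' := (mem_filter.1 ht').2.1
    refine (StrictMono.range_inj hm hm').1 (Set.ext fun x => ?_)
    have := Finset.ext_iff.1 h x
    simpa [Fin.val_inj] using this
  · intro s hs
    obtain ⟨hs, hadm, hcard⟩ := mem_filter.1 hs
    have hcard' : #s = a := by exact_mod_cast hcard
    have hlt : ∀ k, s.orderEmbOfFin hcard' k < 2 * n := fun k => by
      have := mem_Ico.1 (mem_powerset.1 hs (s.orderEmbOfFin_mem hcard' k))
      lia
    have hm : StrictMono (fun k => (⟨s.orderEmbOfFin hcard' k, hlt k⟩ : Fin (2 * n))) :=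
      fun k l hkl => Fin.lt_def.2 ((s.orderEmbOfFin hcard').strictMono hkl)
    have him : (univ.image fun k => s.orderEmbOfFin hcard' k) = s :=
      s.image_orderEmbOfFin_univ hcard'
    refine ⟨fun k => ⟨s.orderEmbOfFin hcard' k, hlt k⟩, ?_, him⟩
    rw [mem_filter]
    refine ⟨mem_univ _, hm, (admQ_iff_admSet_image n _ hm).2 ?_⟩
    change AdmSet n (univ.image fun k => s.orderEmbOfFin hcard' k)
    rwa [him]
  · intro t ht
    have hm := (mem_filter.1 ht).2.1
    rw [setWeight, prod_image (fun x _ y _ h => hm.injective (Fin.val_injective h))]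
    refine prod_congr rfl fun k _ => ?_
    rw [card_image_filter_lt t hm k]
    congr 2
    ring

theorem T1q_eq_sandCoeff (n : ℕ) (Q : ℕ → ℂ → Kˣ) (a : ℤ) (v : ℂ) :
    T1q n Q a v = sandCoeff (etaq n Q) n a (v + (a : ℂ) / 2 - 1) := by
  have hpos : ∀ (b : ℤ), 0 ≤ b → b ≤ n →
      tabSumQ n Q b.toNat v = sandCoeff (etaq n Q) n b (v + (b : ℂ) / 2 - 1) := by
    intro b hb hbn
    rw [tabSumQ_eq_colSum, colSum_eq_sandCoeff n Q n le_rfl _ _ (by lia)]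
    lift b to ℕ using hb
    simp
  rw [T1q]
  split_ifs with h1 h2 h3 h4
  · rw [sandCoeff_of_neg _ _ _ _ h1]
  · exact hpos a (by lia) h2
  · rw [h3, sandCoeff_middle]
  · rw [hpos _ (by lia) (by lia)]
    have h := sandCoeff_symm (etaq n Q) n (2 * (n : ℤ) + 2 - a) (v + (a : ℂ) / 2 - 1)
    rw [show 2 * (n : ℤ) + 2 - (2 * n + 2 - a) = a by ring] at h
    rw [h, etaq_self, etaq_self]
    push_cast
    rw [show v + (a : ℂ) / 2 - 1 + (2 * n + 2 - a) - n - 1 =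
      v + (2 * (n : ℂ) + 2 - a) / 2 - 1 by ring]
    simp
  · rw [sandCoeff_of_gt _ _ _ _ (by lia)]

theorem seqOp_eq_sandOp (η : ℕ → ℂ → Kˣ) (n : ℕ) (a : ℕ → ℂ → K)
    (hlow : ∀ r < n, ∀ u, a (n - 1 - r) u =
      ((η r (u + r + 1) * (η (r + 1) (u + r + 2))⁻¹ : Kˣ) : K))
    (hhigh : ∀ r < n, ∀ u, a (n + r + 2) u = ((η (r + 1) u * (η r u)⁻¹ : Kˣ) : K))
    (hmid : ∀ f u, diffOp (a n) (diffOp (a (n + 1)) f) u =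
      f (u + 2) - ((η 0 u * (η 0 (u + 1))⁻¹ : Kˣ) : K) * f u)
    (r : ℕ) (hr : r ≤ n) (f : ℂ → K) :
    seqOp (fun i => a (n - r + i)) (2 * r + 2) f = sandOp η r f := by
  induction r generalizing f with
  | zero => exact funext fun u => hmid f u
  | succ r ih =>
    change diffOp (a (n - (r + 1))) (seqOp (fun i => a (n - (r + 1) + (i + 1)))
      (2 * r + 2 + 1) f) = _
    have h1 : (fun i => a (n - (r + 1) + (i + 1))) = fun i => a (n - r + i) := by
      funext i; congr 1; lia
    rw [h1, seqOp_succ_last, ih (by lia), sandOp]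
    congr 1
    · funext u
      rw [← hlow r (by lia)]
      congr 1; lia
    · congr 1
      congr 1
      funext u
      rw [← hhigh r (by lia)]
      congr 1; lia

theorem etaq_zero_ratio (n : ℕ) (hn : n ≠ 0) (Q : ℕ → ℂ → Kˣ) (u : ℂ) :
    xqmid n Q u * xqmid n Q (u - 1) =
      ((etaq n Q 0 u * (etaq n Q 0 (u + 1))⁻¹ : Kˣ) : K) := by
  simp only [xqmid, etaq, Yq, Nat.sub_zero, if_neg hn, if_true]
  rw [show u - 1 + (n : ℂ) / 2 = u + n / 2 - 1 by ring,
    show u - 1 + ((n : ℂ) + 4) / 2 = u + n / 2 + 1 by ring,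
    show u - 1 + ((n : ℂ) + 2) / 2 = u + n / 2 by ring,
    show u + ((n : ℂ) + 4) / 2 = u + n / 2 + 2 by ring,
    show u + ((n : ℂ) + 2) / 2 = u + n / 2 + 1 by ring,
    show u + 1 + (n : ℂ) / 2 - 1 = u + n / 2 by ring,
    show u + 1 + (n : ℂ) / 2 + 1 = u + n / 2 + 2 by ring]
  norm_cast
  generalize Q n (u + n / 2) = a
  generalize Q n (u + n / 2 + 1) = b
  generalize Q n (u + n / 2 + 2) = c
  generalize Q n (u + n / 2 - 1) = d
  rw [mul_inv, inv_inv, pow_two, pow_two]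
  calc a * c * (b⁻¹ * b⁻¹) * (d * b * (a⁻¹ * a⁻¹)) =
        (a * a⁻¹) * (b * b⁻¹) * (d * b⁻¹ * (a⁻¹ * c)) := by ac_rfl
    _ = _ := by simp

theorem xq_low (n : ℕ) (Q : ℕ → ℂ → Kˣ) (r : ℕ) (hr : r < n) (u : ℂ) :
    xq n Q (n - 1 - r + 1) (u + n - ((n - 1 - r : ℕ) : ℂ)) =
      ((etaq n Q r (u + r + 1) * (etaq n Q (r + 1) (u + r + 2))⁻¹ : Kˣ) : K) := by
  rw [xq, if_pos (by lia), show n - 1 - r + 1 = n - r by lia, zq_sub n Q r hr,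
    Nat.sub_sub, Nat.cast_sub (by lia)]
  push_cast
  rw [show u + (n : ℂ) - (n - (1 + r)) = u + r + 1 by ring,
    show u + (r : ℂ) + 1 + 1 = u + r + 2 by ring]

theorem xq_high (n : ℕ) (Q : ℕ → ℂ → Kˣ) (r : ℕ) (hr : r < n) (u : ℂ) :
    xq n Q (n + r + 2 + 1) (u + n - ((n + r + 2 : ℕ) : ℂ)) =
      ((etaq n Q (r + 1) u * (etaq n Q r u)⁻¹ : Kˣ) : K) := by
  rw [xq, if_neg (by lia), if_neg (by lia), if_neg (by lia),
    show n + r + 2 + 1 - 2 = n + r + 1 by lia, zq_add n Q r hr]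
  push_cast
  rw [show u + (n : ℂ) - (n + r + 2) + r + 2 = u by ring]

theorem seqOp_xq_eq_sandOp (n : ℕ) (hn : n ≠ 0) (Q : ℕ → ℂ → Kˣ) (f : ℂ → K) :
    seqOp (fun i u => xq n Q (i + 1) (u + n - (i : ℂ))) (2 * n + 2) f =
      sandOp (etaq n Q) n f := by
  have h := seqOp_eq_sandOp (etaq n Q) n (fun i u => xq n Q (i + 1) (u + n - (i : ℂ)))
    (xq_low n Q) (xq_high n Q) ?_ n le_rfl f
  · simpa using h
  · intro f u
    rw [← etaq_zero_ratio n hn]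
    simp only [diffOp, xq]
    simp
    rw [show u + 1 + 1 = u + 2 by ring, show u + 1 + (n : ℂ) - (n + 1) = u by ring,
      show u + (n : ℂ) - (n + 1) = u - 1 by ring]
    ring

theorem Ljq_eq_sandOp (n : ℕ) (hn : n ≠ 0) (Q : ℕ → ℂ → Kˣ) (f : ℂ → K) :
    Ljq n Q (2 * n + 2) f = sandOp (etaq n Q) n f := by
  have h := seqOp_eq_sandOp (etaq n Q) n
    (fun i u => epsq n (i + 1) * xq n Q (i + 1) (u + n - (i : ℂ))) ?_ ?_ ?_ n le_rfl f
  · rw [← h, ← opProd_map_range, Ljq]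
    congr 2
    funext r
    funext g u
    rw [diffOp, show 2 * n + 3 - (2 * n + 2) + r = r + 1 by lia, show n - n + r = r by lia]
    push_cast
    rw [show u + (n : ℂ) + 1 - (r + 1) = u + n - r by ring]
  · intro r hr u
    rw [epsq, if_neg (by lia), one_mul, xq_low n Q r hr]
  · intro r hr u
    rw [epsq, if_neg (by lia), one_mul, xq_high n Q r hr]
  · intro f u
    rw [← etaq_zero_ratio n hn]
    simp only [diffOp, xq, epsq]
    simp
    rw [show u + 1 + 1 = u + 2 by ring, show u + 1 + (n : ℂ) - (n + 1) = u by ring,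
      show u + (n : ℂ) - (n + 1) = u - 1 by ring]
    ring

theorem sandCoeff_zero (η : ℕ → ℂ → Kˣ) (r : ℕ) (v : ℂ) : sandCoeff η r 0 v = 1 := by
  induction r generalizing v with
  | zero => simp [sandCoeff]
  | succ r ih =>
    rw [sandCoeff, ih, sandCoeff_of_neg η r (0 - 1) _ (by lia),
      sandCoeff_of_neg η r (0 - 1) _ (by lia), sandCoeff_of_neg η r (0 - 2) _ (by lia)]
    ring

/-- the matrix of `sandOp η n` on the points `u, u + 1, …`. -/
def bandMatrix (η : ℕ → ℂ → Kˣ) (n : ℕ) (u : ℂ) (r c : ℕ) : K :=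
  (-1) ^ (c + r) * sandCoeff η n (2 * (n : ℤ) + 2 - c + r) (u + r + n)

theorem sandOp_eq_sum_bandMatrix (η : ℕ → ℂ → Kˣ) (n m : ℕ) (u : ℂ) (r : ℕ)
    (hm : r + (2 * n + 2) < m) (f : ℂ → K) :
    sandOp η n f (u + r) = ∑ c ∈ range m, bandMatrix η n u r c * f (u + c) := by
  have hsub : Ico r (r + (2 * n + 3)) ⊆ range m := by
    intro c hc; rw [mem_Ico] at hc; rw [mem_range]; lia
  rw [← sum_subset hsub, sum_Ico_eq_sum_range, show r + (2 * n + 3) - r = 2 * n + 3 by lia,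
    ← sum_range_reflect, sandOp_eq_sum]
  · refine sum_congr rfl fun a ha => ?_
    rw [mem_range] at ha
    rw [bandMatrix]
    have h1 : ((r + (2 * n + 3 - 1 - a) : ℕ) : ℤ) = r + (2 * n + 2 - a) := by lia
    have h2 : ((r + (2 * n + 3 - 1 - a) : ℕ) : ℂ) = r + (2 * n + 2 - a) := by
      exact_mod_cast congrArg (Int.cast : ℤ → ℂ) h1
    have h3 : (-1 : K) ^ (r + (2 * n + 3 - 1 - a) + r) = (-1) ^ a := by
      refine neg_one_pow_congr ?_
      rw [Nat.even_iff, Nat.even_iff]; lia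
    rw [h1, h2, h3, show 2 * (n : ℤ) + 2 - (r + (2 * n + 2 - a)) + r = a by ring,
      show u + (r + (2 * (n : ℂ) + 2 - a)) = u + r + 2 * n + 2 - a by ring]
  · intro c _ hc
    rw [mem_Ico] at hc
    rw [bandMatrix]
    by_cases h : c < r
    · rw [sandCoeff_of_gt _ _ _ _ (by lia)]; ring
    · rw [sandCoeff_of_neg _ _ _ _ (by lia)]; ring

theorem det_minor_eq_sign_mul {N M : ℕ} (W : Matrix (Fin (N + M)) (Fin N) K)
    (B : Matrix (Fin M) (Fin (N + M)) K) (hBW : B * W = 0)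
    (hB : (B.submatrix id (Fin.natAdd N)).det = 1)
    (τ : Fin N ⊕ Fin M ≃ Fin (N + M)) :
    (W.submatrix (fun α => τ (Sum.inl α)) id).det =
      ((Equiv.Perm.sign (finSumFinEquiv.symm.trans τ) : ℤ) : K) *
        (B.submatrix id (fun k => τ (Sum.inr k))).det *
        (W.submatrix (Fin.castAdd M) id).det := by
  set Z : Matrix (Fin (N + M)) (Fin N ⊕ Fin M) K :=
    Matrix.of fun c x => Sum.elim (fun m => W c m) (fun l => if c = Fin.natAdd N l then 1 else 0) x
    with hZ
  set P : Matrix (Fin N ⊕ Fin M) (Fin N ⊕ Fin M) K :=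
    Matrix.fromBlocks 1 0 (B.submatrix id fun α => τ (Sum.inl α))
      (B.submatrix id fun k => τ (Sum.inr k)) with hP
  have hPdet : P.det = (B.submatrix id (fun k => τ (Sum.inr k))).det := by
    rw [hP, Matrix.det_fromBlocks_zero₁₂, Matrix.det_one, one_mul]
  have hBZ : ∀ (r : Fin M) (x : Fin N ⊕ Fin M), ∑ y, B r (τ y) * Z (τ y) x =
      Sum.elim (fun _ => 0) (fun l => B r (Fin.natAdd N l)) x := by
    intro r x
    rw [Equiv.sum_comp τ (fun c => B r c * Z c x)]
    rcases x with m | l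
    · exact congrFun (congrFun hBW r) m
    · simp [hZ]
  have hmul : P * Z.submatrix τ id = Matrix.fromBlocks (W.submatrix (fun α => τ (Sum.inl α)) id)
      (Matrix.of fun α l => Z (τ (Sum.inl α)) (Sum.inr l)) 0
      (B.submatrix id (Fin.natAdd N)) := by
    ext x y
    rcases x with α | r
    · rw [Matrix.mul_apply, Fintype.sum_sum_type]
      rcases y with m | l <;> simp [hP, Matrix.one_apply] <;> simp [hZ]
    · have := hBZ r y
      rw [Fintype.sum_sum_type] at this
      rw [Matrix.mul_apply, Fintype.sum_sum_type]
      rcases y with m | l <;> simpa [hP] using this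
  have hZ0 : (Z.submatrix finSumFinEquiv id).det = (W.submatrix (Fin.castAdd M) id).det := by
    have : Z.submatrix finSumFinEquiv id = Matrix.fromBlocks (W.submatrix (Fin.castAdd M) id) 0
        (W.submatrix (Fin.natAdd N) id) 1 := by
      ext x y
      rcases x with α | r <;> rcases y with m | l <;>
        simp [hZ, Matrix.one_apply, Fin.ext_iff]
      lia
    rw [this, Matrix.det_fromBlocks_zero₁₂, Matrix.det_one, mul_one]
  have hZτ : (Z.submatrix τ id).det =
      ((Equiv.Perm.sign (finSumFinEquiv.symm.trans τ) : ℤ) : K) *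
        (Z.submatrix finSumFinEquiv id).det := by
    have h := Matrix.det_permute (τ.trans finSumFinEquiv.symm) (Z.submatrix finSumFinEquiv id)
    have hs : Equiv.Perm.sign (τ.trans finSumFinEquiv.symm) =
        Equiv.Perm.sign (finSumFinEquiv.symm.trans τ) := by
      have := Equiv.Perm.sign_symm_trans_trans (τ.trans finSumFinEquiv.symm)
        (finSumFinEquiv (m := N) (n := M))
      rw [← this]
      congr 1
      ext x; simp
    rw [hs] at h
    rw [← h]
    congr 1
    ext x y; simp
  have := congrArg Matrix.det hmul
  rw [Matrix.det_mul, hPdet, hZτ, hZ0, Matrix.det_fromBlocks_zero₂₁, hB, mul_one] at this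
  rw [← this]
  ring

theorem sign_of_strictMono_blocks {N M : ℕ} (τ : Fin N ⊕ Fin M ≃ Fin (N + M))
    (h1 : StrictMono fun α => τ (Sum.inl α)) (h2 : StrictMono fun k => τ (Sum.inr k)) :
    Equiv.Perm.sign (finSumFinEquiv.symm.trans τ) =
      ∏ k : Fin M, (-1) ^ #{α : Fin N | τ (Sum.inr k) < τ (Sum.inl α)} := by
  rw [Equiv.Perm.sign_eq_prod_prod_Iio, Fin.prod_univ_add]
  have e1 : ∀ α : Fin N, (finSumFinEquiv.symm.trans τ) (Fin.castAdd M α) = τ (Sum.inl α) := by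
    intro α; simp
  have e2 : ∀ k : Fin M, (finSumFinEquiv.symm.trans τ) (Fin.natAdd N k) = τ (Sum.inr k) := by
    intro k; simp
  rw [prod_eq_one, one_mul]
  · refine prod_congr rfl fun k _ => ?_
    have : Iio (Fin.natAdd N k) = univ.filter (· < Fin.natAdd N k) := by ext; simp
    rw [this, prod_filter, Fin.prod_univ_add]
    rw [prod_eq_one (s := univ (α := Fin M)), mul_one]
    · rw [← prod_const, prod_filter]
      refine prod_congr rfl fun α _ => ?_
      rw [if_pos (by rw [Fin.lt_def, Fin.val_natAdd, Fin.val_castAdd]; lia), e1, e2]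
      have hne : τ (Sum.inl α) ≠ τ (Sum.inr k) := fun h => by simpa using τ.injective h
      by_cases h : τ (Sum.inl α) < τ (Sum.inr k)
      · rw [if_pos h, if_neg h.not_gt]
      · rw [if_neg h, if_pos (lt_of_le_of_ne (not_lt.1 h) hne.symm)]
    · intro l _
      split_ifs with h h'
      · rfl
      · rw [e2, e2] at h'
        exact absurd (h2 ((Fin.natAdd_lt_natAdd_iff N).1 h)) h'
      · rfl
  · intro α _
    refine prod_eq_one fun x hx => ?_
    rw [mem_Iio] at hx
    induction x using Fin.addCases with
    | left β =>
      rw [e1, e1, if_pos (h1 (Fin.lt_def.2 (Fin.lt_def.1 hx)))]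
    | right l =>
      rw [Fin.lt_def, Fin.val_natAdd, Fin.val_castAdd] at hx
      lia

/-- the length `N - μ'_{k+1}` of the `k`-th column of the skew diagram `(μ_1^N)/μ`. -/
def colLen (N : ℕ) (i : ℕ → ℕ) (k : ℕ) : ℕ := N - muTr N i (k + 1)

theorem add_sub_le_of_increasing {N : ℕ} {i : ℕ → ℕ}
    (hinc : ∀ r : ℕ, r + 1 ≤ N - 1 → i r < i (r + 1)) {α β : ℕ} (hαβ : α ≤ β) (hβ : β < N) :
    i α + (β - α) ≤ i β := by
  induction β, hαβ using Nat.le_induction with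
  | base => simp
  | succ β hle ih =>
    have h1 := ih (by lia)
    have h2 := hinc β (by lia)
    lia

theorem muTr_le (N : ℕ) (i : ℕ → ℕ) (k : ℕ) : muTr N i k ≤ N - 1 :=
  (card_filter_le _ _).trans (by simp)

theorem colLen_le (N : ℕ) (i : ℕ → ℕ) (k : ℕ) : colLen N i k ≤ N := Nat.sub_le _ _

theorem colLen_mono (N : ℕ) (i : ℕ → ℕ) : Monotone (colLen N i) := by
  intro k k' hk
  refine Nat.sub_le_sub_left (card_le_card ?_) N
  intro r hr
  rw [mem_filter] at hr ⊢
  exact ⟨hr.1, by lia⟩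

theorem lt_colLen_iff {N : ℕ} {i : ℕ → ℕ} (h0 : i 0 = 0)
    (hinc : ∀ r : ℕ, r + 1 ≤ N - 1 → i r < i (r + 1)) {α : ℕ} (hα : α < N) (k : ℕ) :
    α < colLen N i k ↔ i α ≤ α + k := by
  rw [colLen, muTr]
  constructor
  · intro h
    by_contra hlt
    have hα0 : α ≠ 0 := by rintro rfl; lia
    have hsub : Icc 1 (N - α) ⊆ (Icc 1 (N - 1)).filter fun r => k + 1 ≤ muRow N i r := by
      intro r hr
      rw [mem_Icc] at hr
      rw [mem_filter, mem_Icc, muRow]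
      have := add_sub_le_of_increasing hinc (α := α) (β := N - r) (by lia) (by lia)
      lia
    have := card_le_card hsub
    rw [Nat.card_Icc] at this
    lia
  · intro h
    have hsub : ((Icc 1 (N - 1)).filter fun r => k + 1 ≤ muRow N i r) ⊆ Icc 1 (N - α - 1) := by
      intro r hr
      rw [mem_filter, mem_Icc, muRow] at hr
      rw [mem_Icc]
      by_contra hr'
      have := add_sub_le_of_increasing hinc (α := N - r) (β := α) (by lia) hα
      lia
    have := card_le_card hsub
    rw [Nat.card_Icc] at this
    lia

theorem inShape_iff {N : ℕ} {i : ℕ → ℕ} (h0 : i 0 = 0)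
    (hinc : ∀ r : ℕ, r + 1 ≤ N - 1 → i r < i (r + 1)) {M : ℕ} (c : Fin N × Fin M) :
    inShape N i M c ↔ (c.1 : ℕ) < colLen N i c.2 := by
  rw [lt_colLen_iff h0 hinc c.1.2, inShape, muRow, Nat.sub_sub_self c.1.2.le]
  have := c.1.2
  lia

/-- the interlacing of the sequence `i` with its complement `k ↦ k + colLen k`. -/
theorem exists_equiv_complement {N : ℕ} (hN : 0 < N) {i : ℕ → ℕ} (h0 : i 0 = 0)
    (hinc : ∀ r : ℕ, r + 1 ≤ N - 1 → i r < i (r + 1)) :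
    ∃ τ : Fin N ⊕ Fin (muRow N i 1) ≃ Fin (N + muRow N i 1),
      (∀ α, (τ (Sum.inl α) : ℕ) = i α) ∧ (∀ k, (τ (Sum.inr k) : ℕ) = k + colLen N i k) := by
  have hi : ∀ α : Fin N, i α < N + muRow N i 1 := by
    intro α
    have := add_sub_le_of_increasing hinc (α := α) (β := N - 1) (by lia) (by lia)
    rw [muRow]
    lia
  have hj : ∀ k : Fin (muRow N i 1), k + colLen N i k < N + muRow N i 1 := by
    intro k
    have := colLen_le N i k
    lia
  let f : Fin N ⊕ Fin (muRow N i 1) → Fin (N + muRow N i 1) :=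
    Sum.elim (fun α => ⟨i α, hi α⟩) fun k => ⟨k + colLen N i k, hj k⟩
  have hne : ∀ (α : Fin N) (k : ℕ), i α ≠ k + colLen N i k := by
    intro α k h
    have := lt_colLen_iff h0 hinc α.2 k
    lia
  have hf : Function.Injective f := by
    rintro (α | k) (β | l) h <;> simp only [f, Sum.elim_inl, Sum.elim_inr, Fin.mk.injEq] at h
    · rcases lt_trichotomy (α : ℕ) β with hlt | heq | hlt
      · have := add_sub_le_of_increasing hinc hlt.le β.2; lia
      · rw [Fin.ext heq]
      · have := add_sub_le_of_increasing hinc hlt.le α.2; lia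
    · exact absurd h (hne α l)
    · exact absurd h.symm (hne β k)
    · rcases lt_trichotomy (k : ℕ) l with hlt | heq | hlt
      · have := colLen_mono N i hlt.le; lia
      · rw [Fin.ext heq]
      · have := colLen_mono N i hlt.le; lia
  refine ⟨Equiv.ofBijective f ((Fintype.bijective_iff_injective_and_card f).2 ⟨hf, by simp⟩),
    fun α => rfl, fun k => rfl⟩

/-- a Casorati determinant of solutions as a complementary minor of the band matrix. -/
theorem casorati_eq_band_minor (η : ℕ → ℂ → Kˣ) (n : ℕ) (w : ℕ → ℂ → K)
    (hw : ∀ m < 2 * n + 2, sandOp η n (w (m + 1)) = 0)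
    (i : ℕ → ℕ) (h0 : i 0 = 0)
    (hinc : ∀ r : ℕ, r + 1 ≤ 2 * n + 1 → i r < i (r + 1)) (u : ℂ) :
    Matrix.det (Matrix.of fun j r : Fin (2 * n + 2) =>
        w ((j : ℕ) + 1) (u + ((i (r : ℕ) : ℕ) : ℂ))) =
      (∏ k : Fin (muRow (2 * n + 2) i 1), (-1) ^ muTr (2 * n + 2) i (k + 1)) *
        Matrix.det (Matrix.of fun l k : Fin (muRow (2 * n + 2) i 1) =>
          bandMatrix η n u l (k + colLen (2 * n + 2) i k)) *
        Matrix.det (Matrix.of fun j r : Fin (2 * n + 2) =>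
          w ((j : ℕ) + 1) (u + ((r : ℕ) : ℂ))) := by
  obtain ⟨τ, hτl, hτr⟩ := exists_equiv_complement (N := 2 * n + 2) (by lia) h0 hinc
  generalize muRow (2 * n + 2) i 1 = M at τ hτl hτr ⊢
  have hinc' : ∀ r : ℕ, r + 1 ≤ 2 * n + 2 - 1 → i r < i (r + 1) := hinc
  let W : Matrix (Fin (2 * n + 2 + M)) (Fin (2 * n + 2)) K :=
    Matrix.of fun c m => w (m + 1) (u + ((c : ℕ) : ℂ))
  let B : Matrix (Fin M) (Fin (2 * n + 2 + M)) K := Matrix.of fun r c => bandMatrix η n u r c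
  have hBW : B * W = 0 := by
    ext r m
    have h := sandOp_eq_sum_bandMatrix η n (2 * n + 2 + M) u r (by lia) (w (m + 1))
    rw [hw m m.2, Finset.sum_range] at h
    exact h.symm
  have hB : (B.submatrix id (Fin.natAdd (2 * n + 2))).det = 1 := by
    rw [Matrix.det_of_isLowerTriangular]
    · refine prod_eq_one fun k _ => ?_
      simp only [B, Matrix.submatrix_apply, Matrix.of_apply, id, Fin.val_natAdd, bandMatrix]
      rw [show 2 * (n : ℤ) + 2 - ((2 * n + 2 + k : ℕ) : ℤ) + (k : ℕ) = 0 by push_cast; ring,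
        sandCoeff_zero, Even.neg_one_pow ⟨n + 1 + k, by ring⟩, one_mul]
    · intro r l hrl
      have hrl' : (r : ℕ) < l := hrl
      simp only [B, Matrix.submatrix_apply, Matrix.of_apply, id, Fin.val_natAdd, bandMatrix]
      rw [sandCoeff_of_neg _ _ _ _ (by push_cast; lia), mul_zero]
  have key := det_minor_eq_sign_mul W B hBW hB τ
  rw [sign_of_strictMono_blocks τ] at key
  · have hsign : ∀ k : Fin M, #{α : Fin (2 * n + 2) | τ (Sum.inr k) < τ (Sum.inl α)} =
        muTr (2 * n + 2) i (k + 1) := by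
      intro k
      have h1 : ∀ α : Fin (2 * n + 2), τ (Sum.inr k) < τ (Sum.inl α) ↔
          ¬ (α : ℕ) < colLen (2 * n + 2) i k := by
        intro α
        rw [Fin.lt_def, hτl, hτr]
        have := lt_colLen_iff h0 hinc' α.2 k
        lia
      have h2 := muTr_le (2 * n + 2) i (k + 1)
      simp only [h1]
      rw [filter_not, card_sdiff_of_subset (filter_subset _ _),
        Fin.card_filter_val_lt]
      simp only [card_univ, Fintype.card_fin, colLen]
      lia
    simp only [hsign] at key
    rw [← Matrix.det_transpose, ← Matrix.det_transpose (Matrix.of fun j r : Fin (2 * n + 2) =>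
          w ((j : ℕ) + 1) (u + ((r : ℕ) : ℂ)))]
    convert key using 1
    · congr 1
      ext α m
      simp [W, hτl]
    · congr 1
      congr 1
      · push_cast; rfl
      · congr 1
        ext l k
        simp [B, hτr]
  · intro α β h
    rw [Fin.lt_def, hτl, hτl]
    have h' : (α : ℕ) < β := h
    have := add_sub_le_of_increasing hinc' h'.le β.2
    lia
  · intro k l h
    rw [Fin.lt_def, hτr, hτr]
    have h' : (k : ℕ) < l := h
    have := colLen_mono (2 * n + 2) i h'.le
    lia

theorem det_T1q_eq_det_band (n : ℕ) (Q : ℕ → ℂ → Kˣ) (i : ℕ → ℕ) (M : ℕ) (u : ℂ) :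
    Matrix.det (Matrix.of fun j l : Fin M =>
      T1q n Q ((muTr (2 * n + 2) i ((j : ℕ) + 1) : ℤ) - (j : ℕ) + (l : ℕ))
        (u + (2 * (n : ℂ) + 2 + ((j : ℕ) : ℂ) + ((l : ℕ) : ℂ) -
          ((muTr (2 * n + 2) i ((j : ℕ) + 1) : ℕ) : ℂ)) / 2)) =
      (∏ k : Fin M, (-1) ^ muTr (2 * n + 2) i (k + 1)) *
        Matrix.det (Matrix.of fun l k : Fin M =>
          bandMatrix (etaq n Q) n u l (k + colLen (2 * n + 2) i k)) := by
  set T : Matrix (Fin M) (Fin M) K := Matrix.of fun j l : Fin M =>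
      T1q n Q ((muTr (2 * n + 2) i ((j : ℕ) + 1) : ℤ) - (j : ℕ) + (l : ℕ))
        (u + (2 * (n : ℂ) + 2 + ((j : ℕ) : ℂ) + ((l : ℕ) : ℂ) -
          ((muTr (2 * n + 2) i ((j : ℕ) + 1) : ℕ) : ℂ)) / 2) with hT
  have hband : (Matrix.of fun l k : Fin M =>
      bandMatrix (etaq n Q) n u l (k + colLen (2 * n + 2) i k)) =
      Matrix.of fun l k : Fin M => (-1 : K) ^ (l : ℕ) *
        (Matrix.of fun l k : Fin M =>
          (-1 : K) ^ ((k : ℕ) + muTr (2 * n + 2) i (k + 1)) * T.transpose l k) l k := by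
    ext l k
    have h2 := muTr_le (2 * n + 2) i (k + 1)
    have h3 : colLen (2 * n + 2) i k + muTr (2 * n + 2) i (k + 1) = 2 * n + 2 := by
      rw [colLen]; lia
    have h4 : ((colLen (2 * n + 2) i k : ℕ) : ℤ) =
      2 * n + 2 - muTr (2 * n + 2) i (k + 1) := by lia
    simp only [Matrix.of_apply, Matrix.transpose_apply, hT, bandMatrix, T1q_eq_sandCoeff]
    rw [← mul_assoc, ← pow_add]
    congr 1
    · refine neg_one_pow_congr ?_
      rw [Nat.even_iff, Nat.even_iff]; omega
    · push_cast
      rw [h4]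
      congr 1
      · ring
      · ring
  rw [hband, Matrix.det_mul_column, Matrix.det_mul_row, Matrix.det_transpose, ← mul_assoc,
    ← mul_assoc, ← prod_mul_distrib, ← prod_mul_distrib]
  rw [prod_eq_one, one_mul]
  intro k _
  rw [← pow_add, ← pow_add]
  exact Even.neg_one_pow ⟨muTr (2 * n + 2) i (k + 1) + k, by ring⟩

/-- the position of the `k`-th particle after `i` steps, if the particles start from `j` and
those in `σ i'` rest in the step `i'` while the others move by one. -/
def stepPos {M N : ℕ} (j : Fin M → ℕ) (σ : Fin N → Finset (Fin M)) (i : ℕ) (k : Fin M) : ℕ :=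
  j k + #{i' : Fin N | (i' : ℕ) < i ∧ k ∉ σ i'}

theorem stepPos_zero {M N : ℕ} (j : Fin M → ℕ) (σ : Fin N → Finset (Fin M)) :
    stepPos j σ 0 = j := by
  funext k
  simp [stepPos]

theorem stepPos_cons_succ {M N : ℕ} (j : Fin M → ℕ) (s : Finset (Fin M))
    (σ : Fin N → Finset (Fin M)) (i : ℕ) :
    stepPos j (Fin.cons s σ : Fin (N + 1) → Finset (Fin M)) (i + 1) =
      stepPos (fun k => if k ∈ s then j k else j k + 1) σ i := by
  funext k
  rw [stepPos, stepPos, Fin.card_filter_univ_succ]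
  by_cases h : k ∈ s
  · simp [h]
  · simp [h]
    lia

theorem det_seqOp_eq_sum {M : ℕ} (N : ℕ) (a : ℕ → ℂ → K) (g : Fin M → ℂ → K) (u : ℂ)
    (j : Fin M → ℕ) (hj : StrictMono j) :
    Matrix.det (Matrix.of fun k l : Fin M => seqOp a N (g l) (u + j k)) =
      ∑ σ : Fin N → Finset (Fin M), if ∀ i ≤ N, StrictMono (stepPos j σ i) then
        (∏ i : Fin N, ∏ k ∈ σ i, -a i (u + stepPos j σ i k)) *
          Matrix.det (Matrix.of fun k l : Fin M => g l (u + stepPos j σ N k)) else 0 := by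
  induction N generalizing a j with
  | zero => simp [seqOp, stepPos_zero, hj]
  | succ N ih =>
    set S : Fin M → ℂ → K := fun l => seqOp (fun i => a (i + 1)) N (g l) with hS
    have hrow : (Matrix.of fun k l : Fin M => seqOp a (N + 1) (g l) (u + j k)) =
        (fun k l => -a 0 (u + j k) * S l (u + j k)) + fun k l => S l (u + j k + 1) := by
      ext k l
      simp only [Matrix.of_apply, Pi.add_apply, seqOp, diffOp, hS]
      ring
    have hsplit := (Matrix.detRowAlternating (n := Fin M) (R := K)).toMultilinearMap.map_add_univ
      (fun k l => -a 0 (u + j k) * S l (u + j k)) (fun k l => S l (u + j k + 1))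
    rw [hrow]
    refine hsplit.trans ?_
    rw [← (Fin.consEquiv fun _ : Fin (N + 1) => Finset (Fin M)).sum_comp, Fintype.sum_prod_type]
    refine sum_congr rfl fun s _ => ?_
    set j' : Fin M → ℕ := fun k => if k ∈ s then j k else j k + 1 with hj'
    have hdet : Matrix.det (Matrix.of (s.piecewise (fun k l => -a 0 (u + j k) * S l (u + j k))
        fun k l => S l (u + j k + 1))) = (∏ k ∈ s, -a 0 (u + j k)) *
        Matrix.det (Matrix.of fun k l => S l (u + j' k)) := by
      have hprod : ∏ k ∈ s, -a 0 (u + j k) = ∏ k, if k ∈ s then -a 0 (u + j k) else 1 := by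
        rw [prod_ite_mem, univ_inter]
      rw [hprod, ← Matrix.det_mul_column]
      congr 1
      ext k l
      by_cases hk : k ∈ s
      · simp [hk, hj']
      · simp [hk, hj', add_assoc]
    refine hdet.trans ?_
    by_cases hmono : StrictMono j'
    · rw [ih _ j' hmono, mul_sum]
      refine sum_congr rfl fun σ _ => ?_
      have hiff : (∀ i ≤ N + 1, StrictMono (stepPos j
          (Fin.cons s σ : Fin (N + 1) → Finset (Fin M)) i)) ↔
          ∀ i ≤ N, StrictMono (stepPos j' σ i) := by
        constructor
        · intro h i hi
          have := h (i + 1) (by lia)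
          rwa [stepPos_cons_succ] at this
        · rintro h (_ | i) hi
          · rwa [stepPos_zero]
          · rw [stepPos_cons_succ]
            exact h i (by lia)
      change _ = if ∀ i ≤ N + 1, StrictMono (stepPos j
          (Fin.cons s σ : Fin (N + 1) → Finset (Fin M)) i) then
        (∏ i : Fin (N + 1), ∏ k ∈ (Fin.cons s σ : Fin (N + 1) → Finset (Fin M)) i,
          -a i (u + stepPos j (Fin.cons s σ : Fin (N + 1) → Finset (Fin M)) i k)) *
        Matrix.det (Matrix.of fun k l : Fin M =>
          g l (u + stepPos j (Fin.cons s σ : Fin (N + 1) → Finset (Fin M)) (N + 1) k)) else 0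
      simp only [hiff, stepPos_cons_succ, Fin.prod_univ_succ, Fin.cons_zero, Fin.cons_succ,
        Fin.val_zero, Fin.val_succ, stepPos_zero]
      split_ifs
      · rw [mul_assoc]
      · rw [mul_zero]
    · have hzero : Matrix.det (Matrix.of fun k l => S l (u + j' k)) = 0 := by
        have hmon : Monotone j' := by
          intro k l hkl
          rcases hkl.lt_or_eq with h | rfl
          · have := hj h
            simp only [hj']
            split_ifs <;> lia
          · exact le_rfl
        have hinj : ¬ Function.Injective j' := fun h => hmono (hmon.strictMono_of_injective h)
        rw [Function.Injective] at hinj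
        push Not at hinj
        obtain ⟨k, l, hkl, hne⟩ := hinj
        refine Matrix.det_zero_of_row_eq hne ?_
        funext m
        simp [hkl]
      rw [hzero, mul_zero]
      symm
      refine sum_eq_zero fun σ _ => if_neg fun h => hmono ?_
      have := h 1 (by lia)
      exact (stepPos_zero j' σ) ▸ (stepPos_cons_succ j s σ 0) ▸ this

theorem det_ite_eq_of_strictMono {M : ℕ} (N : ℕ) (p : Fin M → ℕ) (hp : StrictMono p) :
    Matrix.det (Matrix.of fun k l : Fin M => if p k = N + l then (1 : K) else 0) =
      if ∀ k, p k = N + k then 1 else 0 := by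
  split_ifs with h
  · rw [← Matrix.det_one (n := Fin M)]
    congr 1
    ext k l
    simp [h, Matrix.one_apply, Fin.ext_iff]
  · by_contra hdet
    have hex : ∀ k, ∃ l : Fin M, p k = N + l := by
      intro k
      by_contra hk
      push Not at hk
      exact hdet (Matrix.det_eq_zero_of_row_eq_zero k fun l => by simp [hk])
    choose π hπ using hex
    have hmono : StrictMono π := by
      intro k l hkl
      have := hp hkl
      rw [hπ, hπ] at this
      rw [Fin.lt_def]
      lia
    refine h fun k => ?_
    rw [hπ, le_antisymm (hmono.apply_le) (hmono.le_apply)]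

theorem det_seqOp_single_eq_sum {M : ℕ} (N : ℕ) (a : ℕ → ℂ → K) (u : ℂ)
    (j : Fin M → ℕ) (hj : StrictMono j) :
    Matrix.det (Matrix.of fun k l : Fin M =>
        seqOp a N (fun v => if v = u + ((N + l : ℕ) : ℂ) then 1 else 0) (u + j k)) =
      ∑ σ : Fin N → Finset (Fin M) with
        (∀ i ≤ N, StrictMono (stepPos j σ i)) ∧ ∀ k, stepPos j σ N k = N + k,
        ∏ i : Fin N, ∏ k ∈ σ i, -a i (u + stepPos j σ i k) := by
  rw [det_seqOp_eq_sum N a _ u j hj, sum_filter]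
  refine sum_congr rfl fun σ _ => ?_
  by_cases h : ∀ i ≤ N, StrictMono (stepPos j σ i)
  · have := det_ite_eq_of_strictMono (K := K) N _ (h N le_rfl)
    simp only [add_right_inj, Nat.cast_inj]
    rw [if_pos h, this]
    by_cases h' : ∀ k, stepPos j σ N k = N + k
    · rw [if_pos h', if_pos ⟨h, h'⟩, mul_one]
    · rw [if_neg h', if_neg fun H => h' H.2, mul_zero]
  · rw [if_neg h, if_neg fun H => h H.1]

theorem bandMatrix_eq_neg_seqOp (n : ℕ) (hn : n ≠ 0) (Q : ℕ → ℂ → Kˣ) (u : ℂ) (l p : ℕ) :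
    bandMatrix (etaq n Q) n u l p =
      -seqOp (fun i v => xq n Q (i + 1) (v + n - (i : ℂ))) (2 * n + 2)
        (fun v => if v = u - n - 1 + ((2 * n + 2 + l : ℕ) : ℂ) then 1 else 0)
        (u - n - 1 + p) := by
  rw [seqOp_xq_eq_sandOp n hn Q,
    sandOp_eq_sum_bandMatrix _ n (p + (2 * n + 3) + l) _ p (by lia)]
  simp only [add_right_inj, Nat.cast_inj, mul_ite, mul_one, mul_zero]
  rw [sum_ite_eq' (range (p + (2 * n + 3) + l)), if_pos (by rw [mem_range]; lia), bandMatrix,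
    bandMatrix]
  have h := sandCoeff_symm (etaq n Q) n ((p : ℤ) - l) (u + l + n)
  have hs : (-1 : K) ^ (2 * n + 2 + l + p) = (-1) ^ (p + l) := by
    refine neg_one_pow_congr ?_
    rw [Nat.even_iff, Nat.even_iff]; omega
  rw [show 2 * (n : ℤ) + 2 - p + l = 2 * n + 2 - (p - l) by ring, h, hs]
  simp only [etaq_self]
  push_cast
  rw [show 2 * (n : ℤ) + 2 - (2 * n + 2 + l) + p = p - l by ring,
    show u + l + n + (p - l) - n - 1 = u - n - 1 + (p : ℂ) + n by ring]
  simp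

theorem mem_iff_lt_card_of_lower {N : ℕ} (A : Finset (Fin N))
    (hA : ∀ α ∈ A, ∀ β, β ≤ α → β ∈ A) (α : Fin N) : α ∈ A ↔ (α : ℕ) < #A := by
  constructor
  · intro h
    have := card_le_card (show Iic α ⊆ A from fun β hβ => hA α h β (mem_Iic.1 hβ))
    rw [Fin.card_Iic] at this
    lia
  · intro h
    by_contra hα
    have := card_le_card (show A ⊆ Iio α from fun β hβ => mem_Iio.2 (by
      by_contra hlt
      exact hα (hA β hβ α (not_lt.1 hlt))))
    rw [Fin.card_Iio] at this
    lia

theorem exists_le_iff_lt_of_antitone {r : ℕ → ℕ} (hr : Antitone r) {N α : ℕ} (h0 : α < r 0)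
    (hN : r N = 0) : ∃ m : Fin N, ∀ i, i ≤ (m : ℕ) ↔ α < r i := by
  have hP : α < r (Nat.findGreatest (fun i => α < r i) N) :=
    Nat.findGreatest_spec (P := fun i => α < r i) (Nat.zero_le N) h0
  have hle := Nat.findGreatest_le (P := fun i => α < r i) N
  refine ⟨⟨Nat.findGreatest (fun i => α < r i) N, lt_of_le_of_ne hle ?_⟩, fun i => ⟨?_, ?_⟩⟩
  · intro h
    rw [h, hN] at hP
    lia
  · intro h
    exact hP.trans_le (hr h)
  · intro h
    refine Nat.le_findGreatest ?_ h
    by_contra hlt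
    have := hr (not_le.1 hlt).le
    lia

section Tableau

variable {N M : ℕ} {i : ℕ → ℕ}

/-- the sets of columns of a filling which contain a given letter. -/
def letterColumns (t : {c : Fin N × Fin M // inShape N i M c} → Fin N) (m : Fin N) :
    Finset (Fin M) :=
  univ.filter fun k => ∃ c, c.1.2 = k ∧ t c = m

/-- the rows of the `k`-th column whose entry is at least `m`. -/
def rowsGE (t : {c : Fin N × Fin M // inShape N i M c} → Fin N) (k : Fin M) (m : ℕ) :
    Finset (Fin N) :=
  univ.filter fun α => ∃ h : inShape N i M (α, k), m ≤ t ⟨(α, k), h⟩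

theorem isSSYT.column_lt {t : {c : Fin N × Fin M // inShape N i M c} → Fin N}
    (ht : isSSYT N i M t) (h0 : i 0 = 0) (hinc : ∀ r : ℕ, r + 1 ≤ N - 1 → i r < i (r + 1))
    {k : Fin M} {α β : Fin N} (hα : inShape N i M (α, k)) (hβ : inShape N i M (β, k))
    (h : β < α) : t ⟨(α, k), hα⟩ < t ⟨(β, k), hβ⟩ := by
  obtain ⟨α, hαN⟩ := α
  induction α with
  | zero => exact absurd (Fin.lt_def.1 h) (Nat.not_lt_zero _)
  | succ α ih =>
    have hα' : inShape N i M (⟨α, by lia⟩, k) := by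
      rw [inShape_iff h0 hinc] at hα ⊢
      exact lt_trans (Nat.lt_succ_self α) hα
    have hstep : t ⟨(⟨α + 1, hαN⟩, k), hα⟩ < t ⟨(⟨α, by lia⟩, k), hα'⟩ := ht.2 _ _ rfl rfl
    rcases (Nat.lt_succ_iff.1 (Fin.lt_def.1 h)).lt_or_eq with hlt | heq
    · exact hstep.trans (ih (by lia) hα' hlt)
    · obtain rfl : β = ⟨α, by lia⟩ := Fin.ext heq
      exact hstep

theorem isSSYT.row_le {t : {c : Fin N × Fin M // inShape N i M c} → Fin N}
    (ht : isSSYT N i M t) (h0 : i 0 = 0) (hinc : ∀ r : ℕ, r + 1 ≤ N - 1 → i r < i (r + 1))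
    {k l : Fin M} {α : Fin N} (hk : inShape N i M (α, k)) (h : k ≤ l) :
    ∃ hl : inShape N i M (α, l), t ⟨(α, k), hk⟩ ≤ t ⟨(α, l), hl⟩ := by
  obtain ⟨l, hlM⟩ := l
  have hle : (k : ℕ) ≤ l := h
  clear h
  induction l, hle using Nat.le_induction with
  | base => exact ⟨hk, le_rfl⟩
  | succ l hkl ih =>
    obtain ⟨hl, hle⟩ := ih (by lia)
    have hl' : inShape N i M (α, ⟨l + 1, hlM⟩) := by
      rw [inShape_iff h0 hinc] at hl ⊢
      exact hl.trans_le (colLen_mono N i (Nat.le_succ l))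
    exact ⟨hl', hle.trans (ht.1 _ _ rfl rfl)⟩

theorem isSSYT.mem_rowsGE_iff {t : {c : Fin N × Fin M // inShape N i M c} → Fin N}
    (ht : isSSYT N i M t) (h0 : i 0 = 0) (hinc : ∀ r : ℕ, r + 1 ≤ N - 1 → i r < i (r + 1))
    {k : Fin M} {m : ℕ} {α : Fin N} : α ∈ rowsGE t k m ↔ (α : ℕ) < #(rowsGE t k m) := by
  refine mem_iff_lt_card_of_lower _ (fun α hα β hβ => ?_) α
  rw [rowsGE, mem_filter] at hα ⊢
  obtain ⟨-, hsh, hm⟩ := hα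
  have hsh' : inShape N i M (β, k) := by
    rw [inShape_iff h0 hinc] at hsh ⊢
    exact lt_of_le_of_lt hβ hsh
  refine ⟨mem_univ _, hsh', ?_⟩
  rcases hβ.lt_or_eq with hlt | rfl
  · exact hm.trans (Fin.le_def.1 (ht.column_lt h0 hinc hsh hsh' hlt).le)
  · exact hm

theorem isSSYT.stepPos_eq {t : {c : Fin N × Fin M // inShape N i M c} → Fin N}
    (ht : isSSYT N i M t) (h0 : i 0 = 0) (hinc : ∀ r : ℕ, r + 1 ≤ N - 1 → i r < i (r + 1))
    {m : ℕ} (hm : m ≤ N) (k : Fin M) :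
    stepPos (fun k : Fin M => k + colLen N i k) (letterColumns t) m k =
      k + m + #(rowsGE t k m) := by
  have hlen : #(univ.filter fun α : Fin N => inShape N i M (α, k)) = colLen N i k := by
    simp only [inShape_iff h0 hinc]
    rw [Fin.card_filter_val_lt]
    have := colLen_le N i k
    lia
  have hrows : #(univ.filter fun α : Fin N => ∃ h : inShape N i M (α, k),
      (t ⟨(α, k), h⟩ : ℕ) < m) + #(rowsGE t k m) = colLen N i k := by
    rw [← hlen, rowsGE, ← card_union_of_disjoint]
    · congr 1
      ext α
      simp only [mem_union, mem_filter, mem_univ, true_and]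
      constructor
      · rintro (⟨h, -⟩ | ⟨h, -⟩) <;> exact h
      · intro h
        rcases lt_or_ge (t ⟨(α, k), h⟩ : ℕ) m with h' | h'
        · exact Or.inl ⟨h, h'⟩
        · exact Or.inr ⟨h, h'⟩
    · rw [disjoint_filter]
      rintro α - ⟨h, h1⟩ ⟨_, h2⟩
      exact absurd h1 (not_lt.2 h2)
  have hin : #(univ.filter fun m' : Fin N => (m' : ℕ) < m ∧ k ∈ letterColumns t m') =
      #(univ.filter fun α : Fin N => ∃ h : inShape N i M (α, k),
        (t ⟨(α, k), h⟩ : ℕ) < m) := by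
    symm
    refine card_bij (fun α hα => t ⟨(α, k), (mem_filter.1 hα).2.choose⟩) ?_ ?_ ?_
    · intro α hα
      obtain ⟨h, hlt⟩ := (mem_filter.1 hα).2
      simp only [letterColumns, mem_filter, mem_univ, true_and]
      exact ⟨hlt, _, rfl, rfl⟩
    · intro α hα β hβ heq
      by_contra hne
      rcases lt_or_gt_of_ne hne with h | h
      · exact (ht.column_lt h0 hinc _ _ h).ne heq.symm
      · exact (ht.column_lt h0 hinc _ _ h).ne heq
    · intro m' hm'
      simp only [letterColumns, mem_filter, mem_univ, true_and] at hm'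
      obtain ⟨hlt, ⟨⟨α, l⟩, hc⟩, hl, hc'⟩ := hm'
      obtain rfl : l = k := hl
      refine ⟨α, ?_, hc'⟩
      simp only [mem_filter, mem_univ, true_and]
      exact ⟨hc, by rw [hc']; exact hlt⟩
  have hsum : #(univ.filter fun m' : Fin N => (m' : ℕ) < m ∧ k ∈ letterColumns t m') +
      #(univ.filter fun m' : Fin N => (m' : ℕ) < m ∧ k ∉ letterColumns t m') = m := by
    rw [← filter_filter, ← filter_filter, card_filter_add_card_filter_not, Fin.card_filter_val_lt]
    lia
  rw [stepPos]
  lia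

theorem isSSYT.valid {t : {c : Fin N × Fin M // inShape N i M c} → Fin N}
    (ht : isSSYT N i M t) (h0 : i 0 = 0) (hinc : ∀ r : ℕ, r + 1 ≤ N - 1 → i r < i (r + 1)) :
    (∀ m ≤ N, StrictMono
      (stepPos (fun k : Fin M => k + colLen N i k) (letterColumns t) m)) ∧
    ∀ k : Fin M, stepPos (fun k : Fin M => k + colLen N i k) (letterColumns t) N k = N + k := by
  constructor
  · intro m hm k l hkl
    rw [ht.stepPos_eq h0 hinc hm, ht.stepPos_eq h0 hinc hm]
    have hsub : rowsGE t k m ⊆ rowsGE t l m := by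
      intro α hα
      rw [rowsGE, mem_filter] at hα ⊢
      obtain ⟨-, h, hle⟩ := hα
      obtain ⟨h', hle'⟩ := ht.row_le h0 hinc h hkl.le
      exact ⟨mem_univ _, h', hle.trans hle'⟩
    have := card_le_card hsub
    have : (k : ℕ) < l := hkl
    lia
  · intro k
    have : rowsGE t k N = ∅ := by
      refine filter_eq_empty_iff.2 ?_
      rintro α - ⟨h, hle⟩
      have := (t ⟨(α, k), h⟩).2
      lia
    rw [ht.stepPos_eq h0 hinc le_rfl, this, card_empty]
    lia

theorem isSSYT.eq_of_letterColumns_eq {t t' : {c : Fin N × Fin M // inShape N i M c} → Fin N}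
    (ht : isSSYT N i M t) (ht' : isSSYT N i M t') (h0 : i 0 = 0)
    (hinc : ∀ r : ℕ, r + 1 ≤ N - 1 → i r < i (r + 1))
    (h : letterColumns t = letterColumns t') : t = t' := by
  have hcard : ∀ (k : Fin M) (m : ℕ), m ≤ N → #(rowsGE t k m) = #(rowsGE t' k m) := by
    intro k m hm
    have h1 := ht.stepPos_eq h0 hinc hm k
    have h2 := ht'.stepPos_eq h0 hinc hm k
    rw [h, h2] at h1
    lia
  have hiff : ∀ (k : Fin M) (α : Fin N) (m : ℕ), m ≤ N →
      (α ∈ rowsGE t k m ↔ α ∈ rowsGE t' k m) := by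
    intro k α m hm
    rw [ht.mem_rowsGE_iff h0 hinc, ht'.mem_rowsGE_iff h0 hinc, hcard k m hm]
  funext ⟨⟨α, k⟩, hc⟩
  refine le_antisymm ?_ ?_
  · have := (hiff k α (t ⟨(α, k), hc⟩) (t _).2.le).1 (mem_filter.2 ⟨mem_univ _, hc, le_rfl⟩)
    exact (mem_filter.1 this).2.choose_spec
  · have := (hiff k α (t' ⟨(α, k), hc⟩) (t' _).2.le).2 (mem_filter.2 ⟨mem_univ _, hc, le_rfl⟩)
    exact (mem_filter.1 this).2.choose_spec

theorem exists_isSSYT_letterColumns_eq (h0 : i 0 = 0)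
    (hinc : ∀ r : ℕ, r + 1 ≤ N - 1 → i r < i (r + 1)) (σ : Fin N → Finset (Fin M))
    (hmono : ∀ m ≤ N, StrictMono (stepPos (fun k : Fin M => k + colLen N i k) σ m))
    (hend : ∀ k : Fin M, stepPos (fun k : Fin M => k + colLen N i k) σ N k = N + k) :
    ∃ t : {c : Fin N × Fin M // inShape N i M c} → Fin N,
      isSSYT N i M t ∧ letterColumns t = σ := by
  let r : Fin M → ℕ → ℕ := fun k m => #(univ.filter fun m' : Fin N => m ≤ (m' : ℕ) ∧ k ∈ σ m')
  have hpos : ∀ (k : Fin M) (m : ℕ), m ≤ N →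
      stepPos (fun k : Fin M => k + colLen N i k) σ m k = k + m + r k m := by
    intro k m hm
    have h1 := hend k
    have h2 : #(univ.filter fun m' : Fin N => (m' : ℕ) < N ∧ k ∉ σ m') =
        #(univ.filter fun m' : Fin N => (m' : ℕ) < m ∧ k ∉ σ m') +
        #(univ.filter fun m' : Fin N => m ≤ (m' : ℕ) ∧ k ∉ σ m') := by
      rw [← card_union_of_disjoint]
      · congr 1
        ext m'
        have := m'.2
        simp only [mem_union, mem_filter, mem_univ, true_and]
        grind
      · rw [disjoint_filter]
        rintro m' - ⟨h, -⟩ ⟨h', -⟩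
        lia
    have h3 : r k m + #(univ.filter fun m' : Fin N => m ≤ (m' : ℕ) ∧ k ∉ σ m') = N - m := by
      simp only [r]
      rw [← filter_filter, ← filter_filter, card_filter_add_card_filter_not]
      have := card_filter_add_card_filter_not (s := (univ : Finset (Fin N)))
        (fun m' : Fin N => m ≤ (m' : ℕ))
      simp only [not_le] at this
      rw [Fin.card_filter_val_lt, card_univ, Fintype.card_fin] at this
      lia
    rw [stepPos] at h1 ⊢
    lia
  have hr0 : ∀ k, r k 0 = colLen N i k := by
    intro k
    have := hpos k 0 (Nat.zero_le N)
    rw [stepPos_zero] at this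
    lia
  have hrN : ∀ k, r k N = 0 := by
    intro k
    have h1 := hpos k N le_rfl
    have h2 := hend k
    lia
  have hanti : ∀ k, Antitone (r k) := by
    intro k m m' hmm'
    refine card_le_card fun x hx => ?_
    rw [mem_filter] at hx ⊢
    exact ⟨hx.1, by lia, hx.2.2⟩
  have hrsucc : ∀ (k : Fin M) (m : Fin N), r k m = r k (m + 1) + if k ∈ σ m then 1 else 0 := by
    intro k m
    have : (univ.filter fun m' : Fin N => (m : ℕ) ≤ (m' : ℕ) ∧ k ∈ σ m') =
        (univ.filter fun m' : Fin N => (m : ℕ) + 1 ≤ (m' : ℕ) ∧ k ∈ σ m') ∪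
          if k ∈ σ m then {m} else ∅ := by
      ext m'
      simp only [mem_union, mem_filter, mem_univ, true_and]
      split_ifs with h
      · simp only [mem_singleton]; grind
      · simp only [notMem_empty]; grind
    simp only [r]
    rw [this, card_union_of_disjoint]
    · split_ifs <;> simp
    · split_ifs <;> simp
  have hmon : ∀ {k l : Fin M}, (k : ℕ) + 1 = l → ∀ m ≤ N, r k m ≤ r l m := by
    intro k l hkl m hm
    have := hmono m hm (show k < l by rw [Fin.lt_def]; lia)
    rw [hpos k m hm, hpos l m hm] at this
    lia
  have hex : ∀ c : {c : Fin N × Fin M // inShape N i M c},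
      ∃ m : Fin N, ∀ x, x ≤ (m : ℕ) ↔ (c.1.1 : ℕ) < r c.1.2 x := by
    rintro ⟨c, hc⟩
    rw [inShape_iff h0 hinc] at hc
    exact exists_le_iff_lt_of_antitone (hanti c.2) (by rwa [hr0]) (hrN c.2)
  choose t ht using hex
  refine ⟨t, ⟨?_, ?_⟩, ?_⟩
  · intro c c' h1 h2
    rw [Fin.le_def, ht c', ← h1]
    exact ((ht c _).1 le_rfl).trans_le (hmon h2 _ (t c).2.le)
  · intro c c' h1 h2
    have h3 : c.1.2 = c'.1.2 := Fin.ext h2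
    rw [Fin.lt_def, ← Nat.succ_le_iff, ht c', ← h3]
    have h4 := (ht c _).1 le_rfl
    have h5 := hrsucc c.1.2 (t c)
    split_ifs at h5 <;> lia
  · funext m
    ext k
    have h5 := hrsucc k m
    rw [letterColumns, mem_filter]
    constructor
    · rintro ⟨-, c, rfl, rfl⟩
      by_contra hk
      rw [if_neg hk] at h5
      have h6 := (ht c _).1 le_rfl
      have h7 := ht c (t c + 1)
      lia
    · intro hk
      rw [if_pos hk] at h5
      have h6 := hanti k (Nat.zero_le m)
      rw [hr0] at h6
      have h7 := colLen_le N i k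
      refine ⟨mem_univ _, ⟨(⟨r k (m + 1), by lia⟩, k), ?_⟩, rfl, ?_⟩
      · rw [inShape_iff h0 hinc]
        change r k (m + 1) < _
        lia
      · refine Fin.ext (le_antisymm ?_ ?_)
        · rw [← not_lt, ← Nat.succ_le_iff, ht]
          exact lt_irrefl _
        · rw [ht]
          change r k (m + 1) < _
          lia

theorem isSSYT.prod_letterColumns {t : {c : Fin N × Fin M // inShape N i M c} → Fin N}
    (ht : isSSYT N i M t) (h0 : i 0 = 0) (hinc : ∀ r : ℕ, r + 1 ≤ N - 1 → i r < i (r + 1))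
    (f : Fin N → ℕ → K) :
    ∏ m : Fin N, ∏ k ∈ letterColumns t m,
        f m (stepPos (fun k : Fin M => k + colLen N i k) (letterColumns t) m k) =
      ∏ c : {c : Fin N × Fin M // inShape N i M c}, f (t c) (c.1.2 + t c + (c.1.1 + 1)) := by
  rw [prod_sigma']
  symm
  refine prod_bij (fun c _ => ⟨t c, c.1.2⟩) ?_ ?_ ?_ ?_
  · intro c _
    rw [mem_sigma]
    exact ⟨mem_univ _, mem_filter.2 ⟨mem_univ _, c, rfl, rfl⟩⟩
  · rintro ⟨⟨α, k⟩, hc⟩ - ⟨⟨β, l⟩, hc'⟩ - heq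
    simp only [Sigma.mk.injEq, heq_eq_eq] at heq
    obtain ⟨heq, rfl⟩ := heq
    rcases lt_trichotomy α β with h | rfl | h
    · exact absurd heq.symm (ht.column_lt h0 hinc hc' hc h).ne
    · rfl
    · exact absurd heq (ht.column_lt h0 hinc hc hc' h).ne
  · rintro ⟨m, k⟩ hmk
    rw [mem_sigma, letterColumns, mem_filter] at hmk
    obtain ⟨-, -, c, rfl, rfl⟩ := hmk
    exact ⟨c, mem_univ _, rfl⟩
  · rintro ⟨⟨α, k⟩, hc⟩ -
    have hcard : #(rowsGE t k (t ⟨(α, k), hc⟩)) = α + 1 := by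
      have : rowsGE t k (t ⟨(α, k), hc⟩) = Iic α := by
        ext β
        rw [mem_Iic, rowsGE, mem_filter]
        constructor
        · rintro ⟨-, h, hle⟩
          by_contra hlt
          have := Fin.lt_def.1 (ht.column_lt h0 hinc h hc (not_le.1 hlt))
          lia
        · intro hβ
          have h : inShape N i M (β, k) := by
            rw [inShape_iff h0 hinc] at hc ⊢
            exact lt_of_le_of_lt hβ hc
          refine ⟨mem_univ _, h, ?_⟩
          rcases hβ.lt_or_eq with hlt | rfl
          · exact Fin.le_def.1 (ht.column_lt h0 hinc hc h hlt).le
          · exact le_rfl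
      rw [this, Fin.card_Iic]
    rw [ht.stepPos_eq h0 hinc (t _).2.le, hcard]

theorem sum_stepPos_eq_sum_isSSYT (h0 : i 0 = 0)
    (hinc : ∀ r : ℕ, r + 1 ≤ N - 1 → i r < i (r + 1)) (f : Fin N → ℕ → K) :
    ∑ σ : Fin N → Finset (Fin M) with
        (∀ m ≤ N, StrictMono (stepPos (fun k : Fin M => k + colLen N i k) σ m)) ∧
          ∀ k : Fin M, stepPos (fun k : Fin M => k + colLen N i k) σ N k = N + k,
        ∏ m : Fin N, ∏ k ∈ σ m, f m (stepPos (fun k : Fin M => k + colLen N i k) σ m k) =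
      ∑ t : {c : Fin N × Fin M // inShape N i M c} → Fin N with isSSYT N i M t,
        ∏ c : {c : Fin N × Fin M // inShape N i M c},
          f (t c) (c.1.2 + t c + (c.1.1 + 1)) := by
  symm
  refine sum_bij (fun t _ => letterColumns t) ?_ ?_ ?_ ?_
  · intro t ht
    exact mem_filter.2 ⟨mem_univ _, (mem_filter.1 ht).2.valid h0 hinc⟩
  · intro t ht t' ht' h
    exact (mem_filter.1 ht).2.eq_of_letterColumns_eq (mem_filter.1 ht').2 h0 hinc h
  · intro σ hσ
    obtain ⟨-, h1, h2⟩ := mem_filter.1 hσ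
    obtain ⟨t, ht, hσt⟩ := exists_isSSYT_letterColumns_eq h0 hinc σ h1 h2
    exact ⟨t, mem_filter.2 ⟨mem_univ _, ht⟩, hσt⟩
  · intro t ht
    exact ((mem_filter.1 ht).2.prod_letterColumns h0 hinc f).symm

end Tableau

theorem prod_cells_neg_one {N M : ℕ} {i : ℕ → ℕ} (h0 : i 0 = 0)
    (hinc : ∀ r : ℕ, r + 1 ≤ N - 1 → i r < i (r + 1)) :
    ∏ _c : {c : Fin N × Fin M // inShape N i M c}, (-1 : K) =
      ∏ k : Fin M, (-1) ^ colLen N i k := by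
  rw [prod_const, card_univ, Fintype.card_subtype, ← prod_const, prod_filter,
    Fintype.prod_prod_type_right]
  refine prod_congr rfl fun k _ => ?_
  simp only [inShape_iff h0 hinc]
  rw [← prod_filter, prod_const, Fin.card_filter_val_lt, min_eq_right (colLen_le N i k)]

/-- the minor of the band matrix as a sum over semistandard tableaux. -/
theorem det_band_eq_sum_isSSYT (n : ℕ) (hn : n ≠ 0) (Q : ℕ → ℂ → Kˣ) (i : ℕ → ℕ) (h0 : i 0 = 0)
    (hinc : ∀ r : ℕ, r + 1 ≤ 2 * n + 1 → i r < i (r + 1)) (M : ℕ) (u : ℂ) :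
    (∏ k : Fin M, (-1) ^ muTr (2 * n + 2) i (k + 1)) *
        Matrix.det (Matrix.of fun l k : Fin M =>
          bandMatrix (etaq n Q) n u l (k + colLen (2 * n + 2) i k)) =
      (-1) ^ M * ∑ t : {c : Fin (2 * n + 2) × Fin M // inShape (2 * n + 2) i M c} →
          Fin (2 * n + 2) with isSSYT (2 * n + 2) i M t,
        ∏ c : {c : Fin (2 * n + 2) × Fin M // inShape (2 * n + 2) i M c},
          xq n Q ((t c : ℕ) + 1) (u + ((c.1.1 : ℕ) : ℂ) + ((c.1.2 : ℕ) : ℂ)) := by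
  have hinc' : ∀ r : ℕ, r + 1 ≤ 2 * n + 2 - 1 → i r < i (r + 1) := hinc
  have hj : StrictMono fun k : Fin M => (k : ℕ) + colLen (2 * n + 2) i k := by
    intro k l hkl
    have : (k : ℕ) < l := hkl
    have := colLen_mono (2 * n + 2) i this.le
    change (k : ℕ) + _ < (l : ℕ) + _
    lia
  have hdet : Matrix.det (Matrix.of fun l k : Fin M =>
      bandMatrix (etaq n Q) n u l (k + colLen (2 * n + 2) i k)) = (-1) ^ M *
      Matrix.det (Matrix.of fun k l : Fin M =>
        seqOp (fun i v => xq n Q (i + 1) (v + n - (i : ℂ))) (2 * n + 2)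
          (fun v => if v = u - n - 1 + ((2 * n + 2 + l : ℕ) : ℂ) then 1 else 0)
          (u - n - 1 + ((k + colLen (2 * n + 2) i k : ℕ) : ℂ))) := by
    rw [← Matrix.det_transpose]
    refine (congrArg Matrix.det ?_).trans
      ((Matrix.det_neg _).trans (congrArg (fun m => (-1) ^ m * _) (Fintype.card_fin M)))
    ext k l
    exact bandMatrix_eq_neg_seqOp n hn Q u l _
  rw [hdet, det_seqOp_single_eq_sum _ _ _ _ hj,
    sum_stepPos_eq_sum_isSSYT h0 hinc' fun (m : Fin (2 * n + 2)) p =>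
      -xq n Q ((m : ℕ) + 1) (u - n - 1 + (p : ℂ) + n - ((m : ℕ) : ℂ)), mul_left_comm]
  congr 1
  rw [mul_sum]
  refine sum_congr rfl fun t _ => ?_
  have hsign : (∏ k : Fin M, (-1 : K) ^ muTr (2 * n + 2) i (k + 1)) *
      ∏ k : Fin M, (-1) ^ colLen (2 * n + 2) i k = 1 := by
    rw [← prod_mul_distrib]
    refine prod_eq_one fun k _ => ?_
    have := muTr_le (2 * n + 2) i (k + 1)
    rw [← pow_add, colLen]
    exact Even.neg_one_pow ⟨n + 1, by lia⟩
  simp only [neg_eq_neg_one_mul (xq _ _ _ _)]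
  rw [prod_mul_distrib, prod_cells_neg_one h0 hinc', ← mul_assoc, hsign, one_mul]
  refine prod_congr rfl fun c _ => ?_
  congr 1
  push_cast
  ring

/-- Lemma B.1 and Proposition B.3 (Weyl type and Jacobi-Trudi formulas for ratios
of Casorati determinants): for `0 = i_0 < i_1 < ⋯ < i_{N-1}` and the associated
Young diagram `μ` (`μ_j = i_{N-j}+j-N`) with transpose `μ'`,
`[0,i_1,…,i_{N-1}](u) = (-1)^{μ_1} (∑_t ∏_{(α,β)} x_{t(α,β)}(u+α+β-2)) ⋅ [0,…,N-1](u)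
 = det_{1≤j,l≤μ_1}(T^{(μ'_j-j+l)}_1(u+(N-2+j+l-μ'_j)/2)) ⋅ [0,…,N-1](u)`,
the sum running over semistandard tableaux of the skew shape `(μ_1^N)/μ` on the
letters `{1,…,N}`. -/
theorem statement19 {K : Type*} [CommRing K] (n : ℕ) (hn : 2 ≤ n) (Q : ℕ → ℂ → Kˣ)
    (w : ℕ → ℂ → K)
    (hw : ∀ m j : ℕ, 1 ≤ m → m ≤ j → j ≤ 2 * n + 2 → Ljq n Q j (w m) = 0)
    (hunit : ∀ (j : ℕ) (u : ℂ), 1 ≤ j → j ≤ 2 * n + 2 → IsUnit (casq w j u))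
    (i : ℕ → ℕ) (h0 : i 0 = 0)
    (hinc : ∀ r : ℕ, r + 1 ≤ 2 * n + 1 → i r < i (r + 1)) (u : ℂ) :
    Matrix.det (Matrix.of fun j r : Fin (2 * n + 2) =>
        w ((j : ℕ) + 1) (u + ((i (r : ℕ) : ℕ) : ℂ))) =
      (-1 : K) ^ (muRow (2 * n + 2) i 1) *
        (∑ t ∈ Finset.univ.filter
            (fun t : {c : Fin (2 * n + 2) × Fin (muRow (2 * n + 2) i 1) //
                inShape (2 * n + 2) i (muRow (2 * n + 2) i 1) c} → Fin (2 * n + 2) =>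
              isSSYT (2 * n + 2) i (muRow (2 * n + 2) i 1) t),
          ∏ c : {c : Fin (2 * n + 2) × Fin (muRow (2 * n + 2) i 1) //
              inShape (2 * n + 2) i (muRow (2 * n + 2) i 1) c},
            xq n Q ((t c : ℕ) + 1) (u + ((c.1.1 : ℕ) : ℂ) + ((c.1.2 : ℕ) : ℂ))) *
        Matrix.det (Matrix.of fun j r : Fin (2 * n + 2) =>
          w ((j : ℕ) + 1) (u + ((r : ℕ) : ℂ))) ∧
    Matrix.det (Matrix.of fun j r : Fin (2 * n + 2) =>
        w ((j : ℕ) + 1) (u + ((i (r : ℕ) : ℕ) : ℂ))) =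
      Matrix.det (Matrix.of fun j l : Fin (muRow (2 * n + 2) i 1) =>
          T1q n Q ((muTr (2 * n + 2) i ((j : ℕ) + 1) : ℤ) - (j : ℕ) + (l : ℕ))
            (u + (2 * (n : ℂ) + 2 + ((j : ℕ) : ℂ) + ((l : ℕ) : ℂ) -
              ((muTr (2 * n + 2) i ((j : ℕ) + 1) : ℕ) : ℂ)) / 2)) *
        Matrix.det (Matrix.of fun j r : Fin (2 * n + 2) =>
          w ((j : ℕ) + 1) (u + ((r : ℕ) : ℂ))) := by
  have hn0 : n ≠ 0 := by lia
  have hcas := casorati_eq_band_minor (etaq n Q) n w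
    (fun m hm => by rw [← Ljq_eq_sandOp n hn0]; exact hw (m + 1) _ (by lia) (by lia) le_rfl)
    i h0 hinc u
  constructor
  · rw [hcas, det_band_eq_sum_isSSYT n hn0 Q i h0 hinc]
  · rw [hcas, det_T1q_eq_det_band]
end
end
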